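/- There exist constants c > 0 and C ≥ 0 such that for every prime p and every set A ⊆ 𝔽_p with 2 ≤ |A| ≤ p^{5/8}, A contains a bi-Sidon subset S ⊆ A with |S| ≥ c · |A|^{2/5} · (log |A|)^{−C}. -/

import Mathlib

/-- A set is additive Sidon if all pairwise sums are distinct. -/
def IsAddSidon {α : Type*} [Add α] (S : Set α) : Prop :=
  ∀ a ∈ S, ∀ b ∈ S, ∀ a' ∈ S, ∀ b' ∈ S, a + b = a' + b' → ({a, b} : Set α) = {a', b'}

/-- A set is multiplicative Sidon if all pairwise products are distinct. -/
def IsMulSidon {α : Type*} [Mul α] (S : Set α) : Prop :=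
  ∀ a ∈ S, ∀ b ∈ S, ∀ a' ∈ S, ∀ b' ∈ S, a * b = a' * b' → ({a, b} : Set α) = {a', b'}

/-- A set is bi-Sidon if it is both additive and multiplicative Sidon. -/
def IsBiSidon {α : Type*} [Add α] [Mul α] (S : Set α) : Prop :=
  IsAddSidon S ∧ IsMulSidon S

/-- The line `{(t, a - u * t, b - u ^ 2 * t)}` of affine three-space: the direction of such a line
lies on a fixed conic. -/
@[ext] structure Ray (K : Type*) where
  /-- the parameter of the direction `(1, -u, -u ^ 2)` -/
  u : K
  /-- the second coordinate of the point with first coordinate `0` -/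
  a : K
  /-- the third coordinate of the point with first coordinate `0` -/
  b : K

namespace Ray

variable {K : Type*} [Field K]

/-- The restriction of a polynomial to a ray, as a polynomial in the parameter of the ray. -/
noncomputable def restrict (q : Ray K) : MvPolynomial (Fin 3) K →ₐ[K] Polynomial K :=
  MvPolynomial.aeval ![Polynomial.X, Polynomial.C q.a - Polynomial.C q.u * Polynomial.X,
    Polynomial.C q.b - Polynomial.C (q.u ^ 2) * Polynomial.X]

/-- The point of a ray with a given parameter. -/
def point (q : Ray K) (t : K) : Fin 3 → K := ![t, q.a - q.u * t, q.b - q.u ^ 2 * t]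

/-- For rays with different directions, this says that they have a point in common. -/
def Cross (q q' : Ray K) : Prop := q.b - q'.b = (q.u + q'.u) * (q.a - q'.a)

/-- The common parameter of the intersection point of two crossing rays. -/
def param (q q' : Ray K) : K := (q'.a - q.a) / (q'.u - q.u)

theorem Cross.symm {q q' : Ray K} (h : Cross q q') : Cross q' q := by
  unfold Cross at *
  linear_combination -h

theorem eval_restrict (q : Ray K) (f : MvPolynomial (Fin 3) K) (t : K) :
    (q.restrict f).eval t = MvPolynomial.eval (q.point t) f := by
  induction f using MvPolynomial.induction_on with
  | C c => simp [restrict]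
  | add f g hf hg => simp [hf, hg]
  | mul_X f i hf =>
    rw [map_mul, Polynomial.eval_mul, hf, map_mul]
    congr 1
    fin_cases i <;> simp [restrict, point]

theorem point_param {q q' : Ray K} (h : Cross q q') (hu : q.u ≠ q'.u) :
    q.point (param q q') = q'.point (param q q') := by
  have h0 : q'.u - q.u ≠ 0 := sub_ne_zero.2 (Ne.symm hu)
  unfold Cross at h
  have h1 : q.a - q.u * param q q' = q'.a - q'.u * param q q' := by
    unfold param; field_simp; ring
  have h2 : q.b - q.u ^ 2 * param q q' = q'.b - q'.u ^ 2 * param q q' := by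
    linear_combination h + (q.u + q'.u) * h1
  unfold point
  rw [h1, h2]

theorem eval_restrict_param {q q' : Ray K} (h : Cross q q') (hu : q.u ≠ q'.u)
    (f : MvPolynomial (Fin 3) K) :
    (q.restrict f).eval (param q q') = (q'.restrict f).eval (param q q') := by
  rw [eval_restrict, eval_restrict, point_param h hu]

/-- Two rays that cross a third one at the same point cross each other. -/
theorem cross_of_param_eq {q q₁ q₂ : Ray K} (h₁ : Cross q q₁) (h₂ : Cross q q₂)
    (hu₁ : q.u ≠ q₁.u) (hu₂ : q.u ≠ q₂.u) (h : param q q₁ = param q q₂) : Cross q₁ q₂ := by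
  have e₁ := point_param h₁ hu₁
  have e₂ := point_param h₂ hu₂
  rw [h] at e₁
  have e := e₁.symm.trans e₂
  have e1 := congrFun e 1
  have e2 := congrFun e 2
  simp only [point, Matrix.cons_val] at e1 e2
  unfold Cross
  linear_combination e2 - (q₁.u + q₂.u) * e1

/-- The derivative in the direction of parameter `s`. -/
noncomputable def dX (s : K) (f : MvPolynomial (Fin 3) K) : MvPolynomial (Fin 3) K :=
  MvPolynomial.pderiv 0 f - MvPolynomial.C s * MvPolynomial.pderiv 1 f
    - MvPolynomial.C (s ^ 2) * MvPolynomial.pderiv 2 f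

/-- The second derivation of the frame adapted to the direction of parameter `s`. -/
noncomputable def dY (s : K) (f : MvPolynomial (Fin 3) K) : MvPolynomial (Fin 3) K :=
  MvPolynomial.pderiv 1 f + MvPolynomial.C (2 * s) * MvPolynomial.pderiv 2 f

/-- The third derivation of the frame adapted to a direction. -/
noncomputable def dZ (f : MvPolynomial (Fin 3) K) : MvPolynomial (Fin 3) K :=
  MvPolynomial.pderiv 2 f

theorem pderiv_pderiv_comm (i j : Fin 3) (f : MvPolynomial (Fin 3) K) :
    MvPolynomial.pderiv i (MvPolynomial.pderiv j f)
      = MvPolynomial.pderiv j (MvPolynomial.pderiv i f) := by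
  induction f using MvPolynomial.induction_on with
  | C c => simp
  | add f g hf hg => simp [hf, hg]
  | mul_X f k hf =>
    simp only [Derivation.leibniz, smul_eq_mul, map_add, hf, MvPolynomial.pderiv_X, Pi.single_apply]
    split_ifs <;> simp <;> ring

theorem dX_dY (s : K) (f : MvPolynomial (Fin 3) K) : dX s (dY s f) = dY s (dX s f) := by
  simp only [dX, dY, map_add, map_sub, MvPolynomial.pderiv_C_mul, pderiv_pderiv_comm 1 0,
    pderiv_pderiv_comm 2 0, pderiv_pderiv_comm 2 1]
  ring

theorem dX_dZ (s : K) (f : MvPolynomial (Fin 3) K) : dX s (dZ f) = dZ (dX s f) := by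
  simp only [dX, dZ, map_sub, MvPolynomial.pderiv_C_mul, pderiv_pderiv_comm 2 0,
    pderiv_pderiv_comm 2 1]

theorem dY_dZ (s : K) (f : MvPolynomial (Fin 3) K) : dY s (dZ f) = dZ (dY s f) := by
  simp only [dY, dZ, map_add, MvPolynomial.pderiv_C_mul, pderiv_pderiv_comm 2 1]

theorem derivative_restrict_pderiv (q : Ray K) (f : MvPolynomial (Fin 3) K) :
    Polynomial.derivative (q.restrict f) = q.restrict (MvPolynomial.pderiv 0 f)
      - Polynomial.C q.u * q.restrict (MvPolynomial.pderiv 1 f)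
      - Polynomial.C (q.u ^ 2) * q.restrict (MvPolynomial.pderiv 2 f) := by
  induction f using MvPolynomial.induction_on with
  | C c => simp [restrict]
  | add f g hf hg => simp only [map_add, hf, hg]; ring
  | mul_X f k hf =>
    simp only [Derivation.leibniz, smul_eq_mul, map_add, map_mul, Polynomial.derivative_mul, hf]
    fin_cases k <;> simp [restrict, MvPolynomial.pderiv_X, Polynomial.derivative_pow] <;> ring

/-- The chain rule along a ray, in the frame adapted to the direction of parameter `s`. -/
theorem derivative_restrict (q : Ray K) (s : K) (f : MvPolynomial (Fin 3) K) :
    Polynomial.derivative (q.restrict f) = q.restrict (dX s f)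
      - Polynomial.C (q.u - s) * q.restrict (dY s f)
      - Polynomial.C ((q.u - s) ^ 2) * q.restrict (dZ f) := by
  rw [derivative_restrict_pderiv]
  have hC : ∀ c : K, q.restrict (MvPolynomial.C c) = Polynomial.C c := by simp [restrict]
  simp only [dX, dY, dZ, map_add, map_sub, map_mul, hC, map_pow, map_ofNat]
  ring

theorem natDegree_restrict_le (q : Ray K) {f : MvPolynomial (Fin 3) K} {e : ℕ}
    (hf : f.totalDegree ≤ e) : (q.restrict f).natDegree ≤ e := by
  have h := MvPolynomial.aeval_natDegree_le (R := K) f hf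
    ![Polynomial.X, Polynomial.C q.a - Polynomial.C q.u * Polynomial.X,
      Polynomial.C q.b - Polynomial.C (q.u ^ 2) * Polynomial.X] (n := 1) (by
        intro i
        fin_cases i
        · simp
        · simp only [Fin.mk_one, Matrix.cons_val]; compute_degree
        · simp only [Fin.reduceFinMk, Matrix.cons_val]; compute_degree)
  simpa [restrict] using h

theorem totalDegree_pderiv_lt {f : MvPolynomial (Fin 3) K} {i : Fin 3}
    (hf : MvPolynomial.pderiv i f ≠ 0) :
    (MvPolynomial.pderiv i f).totalDegree < f.totalDegree := by
  obtain ⟨m, hm, hdeg⟩ : ∃ m ∈ (MvPolynomial.pderiv i f).support,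
      (MvPolynomial.pderiv i f).totalDegree = m.degree := by
    obtain ⟨m, hm, h⟩ := Finset.exists_mem_eq_sup _ (MvPolynomial.support_nonempty.2 hf)
      (fun s : Fin 3 →₀ ℕ => s.sum fun _ e => e)
    exact ⟨m, hm, h⟩
  have h1 : m + Finsupp.single i 1 ∈ f.support := by
    rw [MvPolynomial.mem_support_iff] at hm ⊢
    intro h0
    rw [MvPolynomial.coeff_pderiv, h0, zero_mul] at hm
    exact hm rfl
  have h2 := MvPolynomial.le_totalDegree h1
  change (m + Finsupp.single i 1).degree ≤ _ at h2
  rw [map_add, Finsupp.degree_single] at h2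
  omega

theorem totalDegree_pderiv_le {f : MvPolynomial (Fin 3) K} {e : ℕ} (hf : f.totalDegree ≤ e)
    (i : Fin 3) : (MvPolynomial.pderiv i f).totalDegree ≤ e := by
  by_cases h : MvPolynomial.pderiv i f = 0
  · simp [h]
  · exact (totalDegree_pderiv_lt h).le.trans hf

theorem totalDegree_C_mul_le {f : MvPolynomial (Fin 3) K} {e : ℕ} (hf : f.totalDegree ≤ e)
    (c : K) : (MvPolynomial.C c * f).totalDegree ≤ e :=
  (MvPolynomial.totalDegree_mul _ _).trans (by simpa using hf)

theorem totalDegree_dX_le {f : MvPolynomial (Fin 3) K} {e : ℕ} (hf : f.totalDegree ≤ e) (s : K) :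
    (dX s f).totalDegree ≤ e := by
  refine (MvPolynomial.totalDegree_sub _ _).trans (max_le
    ((MvPolynomial.totalDegree_sub _ _).trans (max_le ?_ ?_)) ?_)
  · exact totalDegree_pderiv_le hf _
  · exact totalDegree_C_mul_le (totalDegree_pderiv_le hf _) _
  · exact totalDegree_C_mul_le (totalDegree_pderiv_le hf _) _

theorem totalDegree_dY_le {f : MvPolynomial (Fin 3) K} {e : ℕ} (hf : f.totalDegree ≤ e) (s : K) :
    (dY s f).totalDegree ≤ e := by
  refine (MvPolynomial.totalDegree_add _ _).trans (max_le ?_ ?_)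
  · exact totalDegree_pderiv_le hf _
  · exact totalDegree_C_mul_le (totalDegree_pderiv_le hf _) _

theorem totalDegree_dZ_le {f : MvPolynomial (Fin 3) K} {e : ℕ} (hf : f.totalDegree ≤ e) :
    (dZ f).totalDegree ≤ e :=
  totalDegree_pderiv_le hf _

theorem _root_.Polynomial.eq_zero_of_natDegree_lt_card_of_injOn {ι : Type*} {P : Polynomial K}
    {Q : Finset ι} {φ : ι → K} (hφ : Set.InjOn φ Q) (hP : ∀ i ∈ Q, P.eval (φ i) = 0)
    (hd : P.natDegree < Q.card) : P = 0 := by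
  classical
  refine Polynomial.eq_zero_of_natDegree_lt_card_of_eval_eq_zero' P (Q.image φ) ?_ ?_
  · simpa using hP
  · rwa [Finset.card_image_of_injOn hφ]

theorem restrict_C (q : Ray K) (c : K) : q.restrict (MvPolynomial.C c) = Polynomial.C c := by
  simp [restrict]

/-- If `f` vanishes on a ray `ℓ` and on a ray `q` crossing it, and also on many rays crossing `q`,
then the two transversal derivatives of `f` along `ℓ` satisfy a differential equation of second
order at the crossing point. -/
theorem eval_transversal_eq_zero {f : MvPolynomial (Fin 3) K} {e : ℕ} (hf : f.totalDegree ≤ e)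
    {l q : Ray K} (hl : l.restrict f = 0) (hq : q.restrict f = 0) (hc : Cross l q)
    (hu : l.u ≠ q.u) {Q : Finset (Ray K)} (hQ : ∀ r ∈ Q, r.restrict f = 0 ∧ Cross q r ∧ q.u ≠ r.u)
    (hinj : Set.InjOn (param q) Q) (hcard : 5 * e < Q.card) :
    let g := l.restrict (dY l.u f)
    let h := l.restrict (dZ f)
    let x := param l q
    g.eval x + (q.u - l.u) * h.eval x = 0 ∧
      (g * (g.derivative.derivative * h - g * h.derivative.derivative)
        - 2 * g.derivative * (g.derivative * h - g * h.derivative)).eval x = 0 := by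
  intro g h x
  set s := l.u with hs
  set v := q.u - s with hv
  have hv0 : v ≠ 0 := sub_ne_zero.2 (Ne.symm hu)
  set F0 := q.restrict (dX s f) with hF0
  set F1 := q.restrict (dY s f) with hF1
  set F2 := q.restrict (dZ f) with hF2
  set A00 := q.restrict (dX s (dX s f)) with hA00
  set A01 := q.restrict (dY s (dX s f)) with hA01
  set A02 := q.restrict (dZ (dX s f)) with hA02
  set A11 := q.restrict (dY s (dY s f)) with hA11
  set A12 := q.restrict (dZ (dY s f)) with hA12
  set A22 := q.restrict (dZ (dZ f)) with hA22
  have hv2 : q.u - s = v := rfl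
  have dF : F0 = Polynomial.C v * F1 + Polynomial.C (v ^ 2) * F2 := by
    have := derivative_restrict q s f
    rw [hq, Polynomial.derivative_zero] at this
    linear_combination -this
  set P := -(F1 + Polynomial.C v * F2) with hP
  have dFP : F0 = - (Polynomial.C v * P) := by
    rw [dF, hP, map_pow]; ring
  set G := F2 ^ 4 * A00 - 2 * P * F2 ^ 3 * A01 + P ^ 2 * F2 ^ 2 * (A11 - 2 * A02)
    + 2 * P ^ 3 * F2 * A12 + P ^ 4 * A22 with hG
  -- vanishing of `G` at the crossings
  have hGr : ∀ r ∈ Q, G.eval (param q r) = 0 := by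
    intro r hr
    obtain ⟨h0, hcr, hur⟩ := hQ r hr
    set y := param q r with hy
    have ev : ∀ k, (r.restrict k).eval y = (q.restrict k).eval y :=
      fun k => (eval_restrict_param hcr hur k).symm
    set w := r.u - s with hw
    have e1 : F0.eval y = w * F1.eval y + w ^ 2 * F2.eval y := by
      have := derivative_restrict r s f
      rw [h0, Polynomial.derivative_zero] at this
      have := congrArg (Polynomial.eval y) this
      simp only [Polynomial.eval_zero, Polynomial.eval_sub, Polynomial.eval_mul,
        Polynomial.eval_C, ev] at this
      linear_combination -this
    have e2 : F0.eval y = v * F1.eval y + v ^ 2 * F2.eval y := by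
      rw [dF]; simp
    have hvw : v - w ≠ 0 := by rw [hv, hw]; intro h; apply hur; linear_combination h
    have e3 : F1.eval y + (v + w) * F2.eval y = 0 := by
      apply mul_left_cancel₀ hvw; linear_combination e1 - e2
    have e4 : P.eval y = w * F2.eval y := by
      rw [hP]; simp only [Polynomial.eval_neg, Polynomial.eval_add, Polynomial.eval_mul,
        Polynomial.eval_C]; linear_combination -e3
    have e5 : A00.eval y - 2 * w * A01.eval y + w ^ 2 * (A11.eval y - 2 * A02.eval y)
        + 2 * w ^ 3 * A12.eval y + w ^ 4 * A22.eval y = 0 := by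
      have d1 := derivative_restrict r s f
      rw [h0, Polynomial.derivative_zero] at d1
      have d2 := congrArg Polynomial.derivative d1
      simp only [Polynomial.derivative_zero, Polynomial.derivative_sub,
        Polynomial.derivative_C_mul] at d2
      rw [derivative_restrict r s (dX s f), derivative_restrict r s (dY s f),
        derivative_restrict r s (dZ f), dX_dY, dX_dZ, dY_dZ] at d2
      have := congrArg (Polynomial.eval y) d2
      simp only [Polynomial.eval_zero, Polynomial.eval_sub, Polynomial.eval_mul,
        Polynomial.eval_C, ev] at this
      linear_combination -this
    rw [hG]
    simp only [Polynomial.eval_add, Polynomial.eval_sub, Polynomial.eval_mul, Polynomial.eval_pow,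
      Polynomial.eval_ofNat, e4]
    linear_combination (F2.eval y) ^ 4 * e5
  have hGdeg : G.natDegree ≤ 5 * e := by
    have a0 : F2.natDegree ≤ e := natDegree_restrict_le _ (totalDegree_dZ_le hf)
    have a1 : F1.natDegree ≤ e := natDegree_restrict_le _ (totalDegree_dY_le hf _)
    have aP : P.natDegree ≤ e := by
      rw [hP, Polynomial.natDegree_neg]
      refine Polynomial.natDegree_add_le_of_degree_le a1 ?_
      exact (Polynomial.natDegree_C_mul_le _ _).trans a0
    have b0 : A00.natDegree ≤ e := natDegree_restrict_le _ (totalDegree_dX_le (totalDegree_dX_le hf _) _)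
    have b1 : A01.natDegree ≤ e := natDegree_restrict_le _ (totalDegree_dY_le (totalDegree_dX_le hf _) _)
    have b2 : A02.natDegree ≤ e := natDegree_restrict_le _ (totalDegree_dZ_le (totalDegree_dX_le hf _))
    have b3 : A11.natDegree ≤ e := natDegree_restrict_le _ (totalDegree_dY_le (totalDegree_dY_le hf _) _)
    have b4 : A12.natDegree ≤ e := natDegree_restrict_le _ (totalDegree_dZ_le (totalDegree_dY_le hf _))
    have b5 : A22.natDegree ≤ e := natDegree_restrict_le _ (totalDegree_dZ_le (totalDegree_dZ_le hf))
    have hm : ∀ (i j : ℕ) (c : Polynomial K), i + j = 4 → c.natDegree ≤ e →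
        (P ^ i * F2 ^ j * c).natDegree ≤ 5 * e := by
      intro i j c hij hc
      have h1 := Polynomial.natDegree_mul_le (p := P ^ i * F2 ^ j) (q := c)
      have h2 := Polynomial.natDegree_mul_le (p := P ^ i) (q := F2 ^ j)
      have h3 := Polynomial.natDegree_pow_le_of_le i aP
      have h4 := Polynomial.natDegree_pow_le_of_le j a0
      have : i * e + j * e = 4 * e := by rw [← add_mul, hij]
      omega
    have hC2 : (2 : Polynomial K) = Polynomial.C 2 := (map_ofNat Polynomial.C 2).symm
    have c2 : ∀ c : Polynomial K, c.natDegree ≤ e → (2 * c).natDegree ≤ e := fun c hc => by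
      rw [hC2]; exact (Polynomial.natDegree_C_mul_le _ _).trans hc
    have : G = P ^ 0 * F2 ^ 4 * A00 - P ^ 1 * F2 ^ 3 * (2 * A01) + P ^ 2 * F2 ^ 2 * (A11 - 2 * A02)
        + P ^ 3 * F2 ^ 1 * (2 * A12) + P ^ 4 * F2 ^ 0 * A22 := by rw [hG]; ring
    rw [this]
    refine Polynomial.natDegree_add_le_of_degree_le (Polynomial.natDegree_add_le_of_degree_le
      (Polynomial.natDegree_add_le_of_degree_le (Polynomial.natDegree_sub_le_of_le
        (hm _ _ _ rfl b0) (hm _ _ _ rfl (c2 _ b1)) |>.trans (max_self _).le)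
        (hm _ _ _ rfl ?_)) (hm _ _ _ rfl (c2 _ b4))) (hm _ _ _ rfl b5)
    exact (Polynomial.natDegree_sub_le_of_le b3 (c2 _ b2)).trans (max_self _).le
  have hG0 : G = 0 :=
    Polynomial.eq_zero_of_natDegree_lt_card_of_injOn hinj hGr (hGdeg.trans_lt hcard)
  -- values at the crossing with `l`
  have ev := fun k => (eval_restrict_param hc hu k).symm
  have hss : l.u - s = 0 := sub_self _
  have dl : ∀ k, Polynomial.derivative (l.restrict k) = l.restrict (dX s k) := by
    intro k; rw [derivative_restrict l s k, hss]; simp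
  have l0 : l.restrict (dX s f) = 0 := by rw [← dl, hl, Polynomial.derivative_zero]
  have l00 : l.restrict (dX s (dX s f)) = 0 := by rw [← dl, l0, Polynomial.derivative_zero]
  have l000 : l.restrict (dX s (dX s (dX s f))) = 0 := by
    rw [← dl, l00, Polynomial.derivative_zero]
  have lg : l.restrict (dY s (dX s f)) = g.derivative := by rw [← dX_dY, ← dl]
  have lh : l.restrict (dZ (dX s f)) = h.derivative := by rw [← dX_dZ, ← dl]
  have lgg : l.restrict (dY s (dX s (dX s f))) = g.derivative.derivative := by
    rw [← dX_dY, ← dl, lg]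
  have lhh : l.restrict (dZ (dX s (dX s f))) = h.derivative.derivative := by
    rw [← dX_dZ, ← dl, lh]
  have x0 : F0.eval x = 0 := by rw [hF0, ev, l0, Polynomial.eval_zero]
  have x1 : F1.eval x = g.eval x := ev _
  have x2 : F2.eval x = h.eval x := ev _
  have x00 : A00.eval x = 0 := by rw [hA00, ev, l00, Polynomial.eval_zero]
  have x01 : A01.eval x = g.derivative.eval x := by rw [hA01, ev, lg]
  have x02 : A02.eval x = h.derivative.eval x := by rw [hA02, ev, lh]
  have xP : P.eval x = 0 := by
    have := congrArg (Polynomial.eval x) dFP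
    rw [x0] at this
    simpa [hv0] using this
  have first : g.eval x + v * h.eval x = 0 := by
    have := xP
    rw [hP] at this
    simp only [Polynomial.eval_neg, Polynomial.eval_add, Polynomial.eval_mul, Polynomial.eval_C,
      x1, x2] at this
    linear_combination -this
  refine ⟨first, ?_⟩
  have x00' : A00.derivative.eval x
      = - v * g.derivative.derivative.eval x - v ^ 2 * h.derivative.derivative.eval x := by
    rw [hA00, derivative_restrict q s]
    simp only [Polynomial.eval_sub, Polynomial.eval_mul, Polynomial.eval_C, x, ev, l000, lgg, lhh,
      Polynomial.eval_zero]
    ring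
  have xP' : P.derivative.eval x = g.derivative.eval x + v * h.derivative.eval x := by
    have h1 := congrArg Polynomial.derivative dFP
    rw [hF0, derivative_restrict q s] at h1
    have h2 := congrArg (Polynomial.eval x) h1
    simp only [Polynomial.derivative_neg, Polynomial.derivative_C_mul, Polynomial.eval_neg,
      Polynomial.eval_sub, Polynomial.eval_mul, Polynomial.eval_C] at h2
    rw [← hA00, ← hA01, ← hA02, x00, x01, x02, hv2] at h2
    apply mul_left_cancel₀ hv0
    linear_combination h2
  have key : h.eval x ^ 3 * (h.eval x * (- v * g.derivative.derivative.eval x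
      - v ^ 2 * h.derivative.derivative.eval x) - 2 * (g.derivative.eval x
        + v * h.derivative.eval x) * g.derivative.eval x) = 0 := by
    have h1 := congrArg (fun k => (Polynomial.derivative k).eval x) hG0
    rw [hG] at h1
    simp only [Polynomial.derivative_add, Polynomial.derivative_sub, Polynomial.derivative_mul,
      Polynomial.derivative_pow, Polynomial.derivative_zero, Polynomial.derivative_ofNat,
      Polynomial.eval_add, Polynomial.eval_sub,
      Polynomial.eval_mul, Polynomial.eval_pow, Polynomial.eval_zero, Polynomial.eval_ofNat,
      Polynomial.eval_C, xP, x00, x00', xP', x01, x2] at h1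
    linear_combination h1
  simp only [Polynomial.eval_sub, Polynomial.eval_mul, Polynomial.eval_ofNat]
  by_cases hx : h.eval x = 0
  · have hg : g.eval x = 0 := by rw [hx] at first; simpa using first
    rw [hx, hg]; ring
  · have k2 := (mul_eq_zero.1 key).resolve_left (pow_ne_zero 3 hx)
    have hg : g.eval x = - (v * h.eval x) := by linear_combination first
    rw [hg]
    linear_combination h.eval x * k2

end Ray

namespace Polynomial

variable {K : Type*} [Field K]

theorem natDegree_eq_of_derivative_mul_eq {p : ℕ} [CharP K p] {P Q : Polynomial K} (hP : P ≠ 0)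
    (hQ : Q ≠ 0) (hPp : P.natDegree < p) (hQp : Q.natDegree < p)
    (h : derivative P * Q = P * derivative Q) : P.natDegree = Q.natDegree := by
  have key : ∀ R : Polynomial K, (X * derivative R).natDegree ≤ R.natDegree ∧
      (X * derivative R).coeff R.natDegree = R.natDegree * R.leadingCoeff := by
    intro R
    have hc : ∀ n, (X * derivative R).coeff n = n * R.coeff n := by
      intro n
      cases n with
      | zero => simp
      | succ n => rw [coeff_X_mul, coeff_derivative]; push_cast; ring
    refine ⟨natDegree_le_iff_coeff_eq_zero.2 fun n hn => ?_, hc _⟩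
    rw [hc, coeff_eq_zero_of_natDegree_lt hn, mul_zero]
  have h1 : (X * derivative P) * Q = P * (X * derivative Q) := by linear_combination X * h
  have h2 := congrArg (fun R => coeff R (P.natDegree + Q.natDegree)) h1
  simp only [coeff_mul_add_eq_of_natDegree_le (key P).1 le_rfl,
    coeff_mul_add_eq_of_natDegree_le le_rfl (key Q).1, (key P).2, (key Q).2] at h2
  have h3 : (P.natDegree : K) = Q.natDegree := by
    have hl : P.leadingCoeff * Q.leadingCoeff ≠ 0 :=
      mul_ne_zero (leadingCoeff_ne_zero.2 hP) (leadingCoeff_ne_zero.2 hQ)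
    apply mul_right_cancel₀ hl
    simp only [leadingCoeff] at h2 ⊢
    linear_combination h2
  exact CharP.natCast_injOn_Iio K p hPp hQp h3

/-- Polynomials of small degree with the same logarithmic derivative are proportional. -/
theorem exists_eq_C_mul_of_derivative_mul_eq {p : ℕ} [CharP K p] {P Q : Polynomial K}
    (hQ : Q ≠ 0) (hPp : P.natDegree < p) (hQp : Q.natDegree < p)
    (h : derivative P * Q = P * derivative Q) : ∃ c, P = C c * Q := by
  by_contra! hne
  have hP : P ≠ 0 := fun h0 => hne 0 (by simp [h0])
  have hd := natDegree_eq_of_derivative_mul_eq hP hQ hPp hQp h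
  set c := P.coeff Q.natDegree / Q.leadingCoeff with hc
  have hR : P - C c * Q ≠ 0 := sub_ne_zero.2 (hne c)
  have hRd : (P - C c * Q).natDegree ≤ Q.natDegree := by
    refine (natDegree_sub_le _ _).trans (max_le hd.le (natDegree_C_mul_le _ _))
  have hR' : derivative (P - C c * Q) * Q = (P - C c * Q) * derivative Q := by
    rw [derivative_sub, derivative_C_mul]
    linear_combination h
  have h2 := natDegree_eq_of_derivative_mul_eq hR hQ (hRd.trans_lt hQp) hQp hR'
  have h3 : (P - C c * Q).coeff Q.natDegree = 0 := by
    have : Q.leadingCoeff ≠ 0 := leadingCoeff_ne_zero.2 hQ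
    rw [coeff_sub, coeff_C_mul, coeff_natDegree, hc]
    field_simp
    ring
  rw [← h2, coeff_natDegree] at h3
  exact hR (leadingCoeff_eq_zero.1 h3)

theorem exists_affine_of_wronskian {p : ℕ} [CharP K p] {g h : Polynomial K} {e : ℕ}
    (hg : g.natDegree ≤ e) (hh : h.natDegree ≤ e) (hp : 2 * e + 1 < p)
    (hΨ : g * (derivative (derivative g) * h - g * derivative (derivative h))
        - 2 * derivative g * (derivative g * h - g * derivative h) = 0) :
    ∃ c d : K, ∀ x v : K, v ≠ 0 → g.eval x + v * h.eval x = 0 → (g.eval x ≠ 0 ∨ h.eval x ≠ 0) →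
      c * v - d * (v * x) + 1 = 0 := by
  by_cases hg0 : g = 0
  · refine ⟨0, 0, fun x v hv h1 h2 => ?_⟩
    subst hg0
    simp only [eval_zero, zero_add, ne_eq, not_true_eq_false, false_or] at h1 h2
    exact absurd ((mul_eq_zero.1 h1).resolve_right h2) hv
  set W := derivative g * h - g * derivative h with hW
  have hW' : derivative W = derivative (derivative g) * h - g * derivative (derivative h) := by
    rw [hW]; simp only [derivative_sub, derivative_mul]; ring
  have hWd : W.natDegree < p := by
    have h1 : (derivative g).natDegree ≤ e := (natDegree_derivative_le g).trans (by omega)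
    have h2 : (derivative h).natDegree ≤ e := (natDegree_derivative_le h).trans (by omega)
    have h3 := natDegree_sub_le (derivative g * h) (g * derivative h)
    have h4 := natDegree_mul_le (p := derivative g) (q := h)
    have h5 := natDegree_mul_le (p := g) (q := derivative h)
    rw [← hW] at h3
    rcases le_max_iff.1 h3 with h | h <;> omega
  obtain ⟨c, hc⟩ := exists_eq_C_mul_of_derivative_mul_eq (p := p) (P := W) (Q := g ^ 2)
    (pow_ne_zero 2 hg0) hWd
    (by have := natDegree_pow_le (p := g) (n := 2); omega) (by
      rw [hW', derivative_pow]; push_cast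
      simp only [map_ofNat, pow_one]
      linear_combination g * hΨ)
  obtain ⟨d, hd⟩ := exists_eq_C_mul_of_derivative_mul_eq (p := p) (P := h + C c * X * g) (Q := g)
    hg0 (by
      have h1 := natDegree_add_le h (C c * X * g)
      have h2 := natDegree_mul_le (p := C c * X) (q := g)
      have h3 := natDegree_C_mul_le c X
      rw [natDegree_X] at h3
      rcases le_max_iff.1 h1 with h | h <;> omega) (by omega) (by
      simp only [derivative_add, derivative_mul, derivative_C, derivative_X]
      rw [hW] at hc
      linear_combination -hc)
  refine ⟨d, c, fun x v _ h1 h2 => ?_⟩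
  have h3 := congrArg (eval x) hd
  simp only [eval_add, eval_mul, eval_C, eval_X] at h3
  have hgx : g.eval x ≠ 0 := by
    intro h0
    rw [h0] at h3
    simp only [mul_zero, add_zero] at h3
    simp [h0, h3] at h2
  apply mul_left_cancel₀ hgx
  linear_combination h1 - v * h3

end Polynomial

namespace Ray

variable {K : Type*} [Field K]

theorem cross_of_collinear {l q₁ q₂ q₃ r : Ray K} (h₁ : Cross l q₁) (h₂ : Cross l q₂)
    (h₃ : Cross l q₃) {c d : K}
    (e₁ : c * (q₁.u - l.u) - d * (q₁.a - l.a) + 1 = 0)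
    (e₂ : c * (q₂.u - l.u) - d * (q₂.a - l.a) + 1 = 0)
    (e₃ : c * (q₃.u - l.u) - d * (q₃.a - l.a) + 1 = 0) (hne : q₁ ≠ q₂)
    (hr₁ : Cross r q₁) (hr₂ : Cross r q₂) : Cross r q₃ := by
  unfold Cross at *
  have hcd : c ≠ 0 ∨ d ≠ 0 := by
    by_contra! h
    simp [h.1, h.2] at e₁
  have hdet : (q₂.u - q₁.u) * (q₃.a - q₁.a) = (q₂.a - q₁.a) * (q₃.u - q₁.u) := by
    rcases hcd with h | h
    · apply mul_left_cancel₀ h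
      linear_combination (q₃.a - q₁.a) * (e₂ - e₁) - (q₂.a - q₁.a) * (e₃ - e₁)
    · apply mul_left_cancel₀ h
      linear_combination (q₃.u - q₁.u) * (e₂ - e₁) - (q₂.u - q₁.u) * (e₃ - e₁)
  have hd : q₂.u - q₁.u ≠ 0 ∨ q₂.a - q₁.a ≠ 0 := by
    by_contra! h
    have hu : q₁.u = q₂.u := by linear_combination -h.1
    have ha : q₁.a = q₂.a := by linear_combination -h.2
    refine hne (Ray.ext hu ha ?_)
    rw [hu, ha] at h₁
    linear_combination h₂ - h₁
  have k₁ : (r.a - l.a) * (q₂.u - q₁.u) = (r.u - l.u) * (q₂.a - q₁.a) := by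
    linear_combination hr₁ - hr₂ - h₁ + h₂
  have k₂ : (r.a - l.a) * (q₃.u - q₁.u) = (r.u - l.u) * (q₃.a - q₁.a) := by
    rcases hd with h | h
    · apply mul_left_cancel₀ h
      linear_combination (q₃.u - q₁.u) * k₁ - (r.u - l.u) * hdet
    · apply mul_left_cancel₀ h
      linear_combination (q₃.a - q₁.a) * k₁ - (r.a - l.a) * hdet
  linear_combination hr₁ - k₂ - h₁ + h₃

theorem exists_reguli {p : ℕ} [CharP K p] {f : MvPolynomial (Fin 3) K} {e : ℕ}
    (hf : f.totalDegree ≤ e) (hp : 2 * e + 1 < p) {l : Ray K} (hl : l.restrict f = 0)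
    (hsing : l.restrict (dY l.u f) ≠ 0 ∨ l.restrict (dZ f) ≠ 0) {N : Finset (Ray K)}
    (hN : ∀ q ∈ N, q.restrict f = 0 ∧ Cross l q ∧ l.u ≠ q.u)
    (hQ : ∀ q ∈ N, ∃ Q : Finset (Ray K), (∀ r ∈ Q, r.restrict f = 0 ∧ Cross q r ∧ q.u ≠ r.u) ∧
      Set.InjOn (param q) Q ∧ 5 * e < Q.card)
    (hinj : Set.InjOn (param l) N) (hcard : 4 * e < N.card) :
    ∃ X ⊆ N, N.card ≤ X.card + e ∧ ∀ r, ∀ q₁ ∈ X, ∀ q₂ ∈ X, q₁ ≠ q₂ → Cross r q₁ → Cross r q₂ →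
      ∀ q₃ ∈ X, Cross r q₃ := by
  classical
  set g := l.restrict (dY l.u f) with hg
  set h := l.restrict (dZ f) with hh
  have hgd : g.natDegree ≤ e := natDegree_restrict_le _ (totalDegree_dY_le hf _)
  have hhd : h.natDegree ≤ e := natDegree_restrict_le _ (totalDegree_dZ_le hf)
  have loc : ∀ q ∈ N, g.eval (param l q) + (q.u - l.u) * h.eval (param l q) = 0 ∧
      (g * (g.derivative.derivative * h - g * h.derivative.derivative)
        - 2 * g.derivative * (g.derivative * h - g * h.derivative)).eval (param l q) = 0 := by
    intro q hq
    obtain ⟨Q, h1, h2, h3⟩ := hQ q hq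
    obtain ⟨h4, h5, h6⟩ := hN q hq
    exact eval_transversal_eq_zero hf hl h4 h5 h6 h1 h2 h3
  have hΨ := Polynomial.eq_zero_of_natDegree_lt_card_of_injOn hinj (fun q hq => (loc q hq).2) (by
    refine lt_of_le_of_lt ?_ hcard
    have g1 : g.derivative.natDegree ≤ e := (Polynomial.natDegree_derivative_le g).trans (by omega)
    have g2 := (Polynomial.natDegree_derivative_le g.derivative)
    have h1 : h.derivative.natDegree ≤ e := (Polynomial.natDegree_derivative_le h).trans (by omega)
    have h2 := (Polynomial.natDegree_derivative_le h.derivative)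
    have h3 : (2 : Polynomial K) = Polynomial.C 2 := (map_ofNat Polynomial.C 2).symm
    have mul : ∀ {A B : Polynomial K} {a b : ℕ}, A.natDegree ≤ a → B.natDegree ≤ b →
        (A * B).natDegree ≤ a + b := fun ha hb => Polynomial.natDegree_mul_le_of_le ha hb
    have sub : ∀ {A B : Polynomial K} {a : ℕ}, A.natDegree ≤ a → B.natDegree ≤ a →
        (A - B).natDegree ≤ a := fun ha hb =>
      (Polynomial.natDegree_sub_le_of_le ha hb).trans (max_self _).le
    refine (sub (mul hgd (sub (mul (g2.trans (by omega : _ ≤ e)) hhd)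
      (mul hgd (h2.trans (by omega : _ ≤ e))))) (a := e + (e + e)) ?_).trans (by omega)
    rw [h3, mul_assoc]
    refine (Polynomial.natDegree_C_mul_le _ _).trans ?_
    exact mul g1 (sub (mul g1 hhd) (mul hgd h1)))
  obtain ⟨c, d, hcd⟩ := Polynomial.exists_affine_of_wronskian hgd hhd hp hΨ
  have hcd' : ∀ q ∈ N, (g.eval (param l q) ≠ 0 ∨ h.eval (param l q) ≠ 0) →
      c * (q.u - l.u) - d * (q.a - l.a) + 1 = 0 := by
    intro q hq hne
    have h1 := hcd _ _ (sub_ne_zero.2 (Ne.symm (hN q hq).2.2)) (loc q hq).1 hne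
    have h2 : (q.u - l.u) * param l q = q.a - l.a := by
      have : q.u - l.u ≠ 0 := sub_ne_zero.2 (Ne.symm (hN q hq).2.2)
      unfold param; field_simp
    rwa [h2] at h1
  refine ⟨N.filter fun q => g.eval (param l q) ≠ 0 ∨ h.eval (param l q) ≠ 0,
    Finset.filter_subset _ _, ?_, ?_⟩
  · rw [← Finset.card_filter_add_card_filter_not
      (s := N) (fun q => g.eval (param l q) ≠ 0 ∨ h.eval (param l q) ≠ 0)]
    refine Nat.add_le_add_left ?_ _
    by_contra hlt
    rw [not_le] at hlt
    have hsub : Set.InjOn (param l)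
        (N.filter fun q => ¬ (g.eval (param l q) ≠ 0 ∨ h.eval (param l q) ≠ 0) : Finset _) :=
      hinj.mono (Finset.coe_subset.2 (Finset.filter_subset _ _))
    rcases hsing with h0 | h0
    · refine h0 (Polynomial.eq_zero_of_natDegree_lt_card_of_injOn hsub ?_ (hgd.trans_lt hlt))
      intro q hq
      simp only [Finset.mem_filter, not_or, not_not] at hq
      exact hq.2.1
    · refine h0 (Polynomial.eq_zero_of_natDegree_lt_card_of_injOn hsub ?_ (hhd.trans_lt hlt))
      intro q hq
      simp only [Finset.mem_filter, not_or, not_not] at hq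
      exact hq.2.2
  · intro r q₁ h₁ q₂ h₂ hne hr₁ hr₂ q₃ h₃
    rw [Finset.mem_filter] at h₁ h₂ h₃
    exact cross_of_collinear (hN _ h₁.1).2.1 (hN _ h₂.1).2.1 (hN _ h₃.1).2.1 (hcd' _ h₁.1 h₁.2)
      (hcd' _ h₂.1 h₂.2) (hcd' _ h₃.1 h₃.2) hne hr₁ hr₂

theorem exists_vanishing (R : Finset (Ray K)) {d : ℕ} (hd : 3 * R.card < d ^ 2) :
    ∃ f : MvPolynomial (Fin 3) K, f ≠ 0 ∧ f.totalDegree ≤ 3 * d ∧ ∀ q ∈ R, q.restrict f = 0 := by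
  classical
  have hd0 : 0 < d := by
    rcases Nat.eq_zero_or_pos d with h | h
    · simp [h] at hd
    · exact h
  let ex : (Fin 3 → Fin d) → (Fin 3 →₀ ℕ) := fun m => Finsupp.equivFunOnFinite.symm fun i => (m i : ℕ)
  have hex : Function.Injective ex := by
    intro m m' h
    funext i
    have := DFunLike.congr_fun h i
    exact Fin.ext this
  let L : ((Fin 3 → Fin d) → K) →ₗ[K] MvPolynomial (Fin 3) K :=
    Fintype.linearCombination K fun m => MvPolynomial.monomial (ex m) 1
  have hL : ∀ c, L c = ∑ m, MvPolynomial.monomial (ex m) (c m) := by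
    intro c
    simp [L, Fintype.linearCombination_apply, MvPolynomial.smul_monomial]
  have hdeg : ∀ c, (L c).totalDegree ≤ 3 * (d - 1) := by
    intro c
    rw [hL]
    refine MvPolynomial.totalDegree_finsetSum_le fun m _ => ?_
    refine (MvPolynomial.totalDegree_monomial_le _ _).trans ?_
    change (ex m).sum (fun _ e => e) ≤ _
    rw [Finsupp.sum_fintype _ _ (fun _ => rfl), Fin.sum_univ_three]
    have h0 := (m 0).2
    have h1 := (m 1).2
    have h2 := (m 2).2
    simp only [ex, Finsupp.equivFunOnFinite_symm_apply_apply]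
    omega
  let M : ((Fin 3 → Fin d) → K) →ₗ[K] (R → Fin (3 * d) → K) :=
    LinearMap.pi fun q => LinearMap.pi fun i =>
      (Polynomial.lcoeff K (i : ℕ)).comp ((q.1.restrict).toLinearMap.comp L)
  have hker : LinearMap.ker M ≠ ⊥ := by
    apply LinearMap.ker_ne_bot_of_finrank_lt
    simp only [Module.finrank_fintype_fun_eq_card, Module.finrank_pi_fintype, Fintype.card_fin,
      Fintype.card_pi, Finset.prod_const, Finset.card_univ, Finset.sum_const, smul_eq_mul,
      Fintype.card_coe]
    nlinarith
  obtain ⟨c, hc, hc0⟩ := (Submodule.ne_bot_iff _).1 hker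
  refine ⟨L c, ?_, (hdeg c).trans (by omega), fun q hq => ?_⟩
  · intro h0
    apply hc0
    funext m
    have := congrArg (MvPolynomial.coeff (ex m)) h0
    rw [hL, MvPolynomial.coeff_sum, Finset.sum_eq_single m] at this
    · simpa using this
    · intro m' _ hne
      rw [MvPolynomial.coeff_monomial, if_neg (fun h => hne (hex h))]
    · simp
  · ext i
    rw [Polynomial.coeff_zero]
    by_cases hi : i < 3 * d
    · have := congrFun (congrFun (LinearMap.mem_ker.1 hc) ⟨q, hq⟩) ⟨i, hi⟩
      simpa [M] using this
    · apply Polynomial.coeff_eq_zero_of_natDegree_lt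
      have := natDegree_restrict_le q (hdeg c)
      omega

theorem eq_C_of_pderiv_eq_zero {p : ℕ} [CharP K p] {f : MvPolynomial (Fin 3) K}
    (hf : f.totalDegree < p) (h : ∀ i, MvPolynomial.pderiv i f = 0) :
    f = MvPolynomial.C (MvPolynomial.coeff 0 f) := by
  classical
  ext m
  rw [MvPolynomial.coeff_C]
  split_ifs with hm
  · rw [hm]
  · by_contra hc
    obtain ⟨i, hi⟩ : ∃ i, m i ≠ 0 := by
      by_contra! h0
      exact hm (Finsupp.ext fun i => (h0 i).symm)
    have h1 := congrArg (MvPolynomial.coeff (m - Finsupp.single i 1)) (h i)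
    have hle : Finsupp.single i 1 ≤ m := by
      rw [Finsupp.single_le_iff]; omega
    rw [MvPolynomial.coeff_pderiv, tsub_add_cancel_of_le hle, MvPolynomial.coeff_zero] at h1
    have h2 := (mul_eq_zero.1 h1).resolve_left hc
    have h3 : ((m i : ℕ) : K) = 0 := by
      rw [← h2, Finsupp.tsub_apply, Finsupp.single_eq_same, ← Nat.cast_succ, Nat.succ_eq_add_one,
        Nat.sub_add_cancel (by omega)]
    rw [CharP.cast_eq_zero_iff K p] at h3
    have h4 := MvPolynomial.le_totalDegree (MvPolynomial.mem_support_iff.2 hc)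
    have h5 : m i ≤ m.sum fun _ e => e := by
      change m i ≤ m.degree
      exact Finsupp.le_degree i m
    exact absurd (Nat.le_of_dvd (by omega) h3) (by omega)

theorem injOn_param {l : Ray K} {N : Finset (Ray K)} (hN : ∀ q ∈ N, Cross l q ∧ l.u ≠ q.u)
    (hne : ∀ q ∈ N, ∀ q' ∈ N, q ≠ q' → ¬ Cross q q') : Set.InjOn (param l) N := by
  intro q hq q' hq' h
  by_contra hqq
  exact hne q hq q' hq' hqq
    (cross_of_param_eq (hN q hq).1 (hN q' hq').1 (hN q hq).2 (hN q' hq').2 h)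

open Classical in
theorem exists_removable_of_mem {p : ℕ} [CharP K p] {R B : Finset (Ray K)} {D k : ℕ}
    (hR : ∀ q ∈ R, ∀ q' ∈ R, q ≠ q' → ¬ Cross q q') (hB : ∀ q ∈ B, ∀ q' ∈ B, q ≠ q' → ¬ Cross q q')
    (hu : ∀ r ∈ R, ∀ b ∈ B, r.u ≠ b.u)
    (hk : ∀ q ∈ B, ∀ q' ∈ B, q ≠ q' → (R.filter fun r => Cross q r ∧ Cross q' r).card ≤ k)
    (hp : 2 * D + 1 < p) (hRD : R.card ≤ D ^ 2) (hD : 0 < D)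
    (hdR : ∀ r ∈ R, 6 * D < (B.filter fun b => Cross r b).card)
    (hdB : ∀ b ∈ B, 6 * D < (R.filter fun r => Cross b r).card)
    {f : MvPolynomial (Fin 3) K} (hf : f.totalDegree ≤ D) (hfR : ∀ r ∈ R, r.restrict f = 0)
    (hfB : ∀ b ∈ B, b.restrict f = 0) {l : Ray K} (hl : l ∈ R)
    (hsing : l.restrict (dY l.u f) ≠ 0 ∨ l.restrict (dZ f) ≠ 0) :
    ∃ X ⊆ B, X.Nonempty ∧
      ∑ x ∈ X, (R.filter fun r => Cross x r).card ≤ (6 * D + k) * X.card := by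
  obtain ⟨X, hX, hXc, hXr⟩ := exists_reguli (N := B.filter fun b => Cross l b) hf hp (hfR l hl)
    hsing (fun q hq => by
      rw [Finset.mem_filter] at hq
      exact ⟨hfB q hq.1, hq.2, hu l hl q hq.1⟩)
    (fun q hq => by
      rw [Finset.mem_filter] at hq
      refine ⟨R.filter fun r => Cross q r, fun r hr => ?_, injOn_param ?_ ?_, ?_⟩
      · rw [Finset.mem_filter] at hr
        exact ⟨hfR r hr.1, hr.2, (hu r hr.1 q hq.1).symm⟩
      · intro r hr
        rw [Finset.mem_filter] at hr
        exact ⟨hr.2, (hu r hr.1 q hq.1).symm⟩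
      · intro r hr r' hr'
        rw [Finset.mem_filter] at hr hr'
        exact hR r hr.1 r' hr'.1
      · have := hdB q hq.1
        omega)
    (injOn_param (fun r hr => by
        rw [Finset.mem_filter] at hr
        exact ⟨hr.2, hu l hl r hr.1⟩) (fun r hr r' hr' => by
        rw [Finset.mem_filter] at hr hr'
        exact hB r hr.1 r' hr'.1))
    (by have := hdR l hl; omega)
  have hXB : X ⊆ B := hX.trans (Finset.filter_subset _ _)
  have hXD : 5 * D < X.card := by have := hdR l hl; omega
  refine ⟨X, hXB, Finset.card_pos.1 (by omega), ?_⟩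
  obtain ⟨x₁, hx₁, x₂, hx₂, hx⟩ := Finset.one_lt_card.1 (show 1 < X.card by omega)
  have hswap : ∑ x ∈ X, (R.filter fun r => Cross x r).card
      = ∑ r ∈ R, (X.filter fun x => Cross r x).card := by
    simp only [Finset.card_filter]
    rw [Finset.sum_comm]
    exact Finset.sum_congr rfl fun r _ => Finset.sum_congr rfl fun x _ => by
      simp only [show Cross x r ↔ Cross r x from ⟨Cross.symm, Cross.symm⟩]
  rw [hswap]
  have hb : ∀ r ∈ R, (X.filter fun x => Cross r x).card
      ≤ 1 + if Cross x₁ r ∧ Cross x₂ r then X.card else 0 := by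
    intro r _
    by_cases h1 : (X.filter fun x => Cross r x).card ≤ 1
    · omega
    · obtain ⟨y₁, hy₁, y₂, hy₂, hy⟩ := Finset.one_lt_card.1 (not_le.1 h1)
      rw [Finset.mem_filter] at hy₁ hy₂
      have := hXr r y₁ hy₁.1 y₂ hy₂.1 hy hy₁.2 hy₂.2
      rw [if_pos ⟨(this x₁ hx₁).symm, (this x₂ hx₂).symm⟩]
      have := Finset.card_filter_le X (fun x => Cross r x)
      omega
  refine (Finset.sum_le_sum hb).trans ?_
  rw [Finset.sum_add_distrib, ← Finset.sum_filter, Finset.sum_const, Finset.sum_const]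
  have h1 := hk x₁ (hXB hx₁) x₂ (hXB hx₂) hx
  simp only [smul_eq_mul, mul_one]
  nlinarith [Nat.mul_le_mul_right X.card h1]

open Classical in
theorem exists_removable {p : ℕ} [CharP K p] {R B : Finset (Ray K)} {d k : ℕ}
    (hR : ∀ q ∈ R, ∀ q' ∈ R, q ≠ q' → ¬ Cross q q') (hB : ∀ q ∈ B, ∀ q' ∈ B, q ≠ q' → ¬ Cross q q')
    (hu : ∀ r ∈ R, ∀ b ∈ B, r.u ≠ b.u)
    (hkB : ∀ q ∈ B, ∀ q' ∈ B, q ≠ q' → (R.filter fun r => Cross q r ∧ Cross q' r).card ≤ k)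
    (hkR : ∀ q ∈ R, ∀ q' ∈ R, q ≠ q' → (B.filter fun r => Cross q r ∧ Cross q' r).card ≤ k)
    (hp : 6 * d + 1 < p) (hRd : 3 * R.card < d ^ 2) (hBd : 3 * B.card < d ^ 2)
    (hne : (R ∪ B).Nonempty) :
    (∃ X ⊆ R, X.Nonempty ∧
      ∑ x ∈ X, (B.filter fun r => Cross x r).card ≤ (18 * d + k) * X.card) ∨
    (∃ X ⊆ B, X.Nonempty ∧
      ∑ x ∈ X, (R.filter fun r => Cross x r).card ≤ (18 * d + k) * X.card) := by
  by_cases hdR : ∀ r ∈ R, 6 * (3 * d) < (B.filter fun b => Cross r b).card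
  swap
  · push Not at hdR
    obtain ⟨r, hr, hle⟩ := hdR
    exact .inl ⟨{r}, by simpa using hr, by simp, by simp; omega⟩
  by_cases hdB : ∀ b ∈ B, 6 * (3 * d) < (R.filter fun r => Cross b r).card
  swap
  · push Not at hdB
    obtain ⟨r, hr, hle⟩ := hdB
    exact .inr ⟨{r}, by simpa using hr, by simp, by simp; omega⟩
  have hd0 : 0 < d := by
    rcases Nat.eq_zero_or_pos d with h | h
    · simp [h] at hRd
    · exact h
  let V : ℕ → Prop := fun e => ∃ f : MvPolynomial (Fin 3) K, f ≠ 0 ∧ f.totalDegree = e ∧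
    ∀ q ∈ R ∪ B, q.restrict f = 0
  obtain ⟨e₀, he₀, he₀d⟩ : ∃ e, V e ∧ e ≤ 3 * d := by
    obtain ⟨f, hf0, hfd, hfR⟩ := exists_vanishing R hRd
    refine ⟨_, ⟨f, hf0, rfl, fun q hq => ?_⟩, hfd⟩
    rcases Finset.mem_union.1 hq with hq | hq
    · exact hfR q hq
    · refine Polynomial.eq_zero_of_natDegree_lt_card_of_injOn
        (Q := R.filter fun r => Cross q r) (φ := param q) (injOn_param ?_ ?_) ?_ ?_
      · intro r hr
        rw [Finset.mem_filter] at hr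
        exact ⟨hr.2, (hu r hr.1 q hq).symm⟩
      · intro r hr r' hr'
        rw [Finset.mem_filter] at hr hr'
        exact hR r hr.1 r' hr'.1
      · intro r hr
        rw [Finset.mem_filter] at hr
        rw [eval_restrict_param hr.2 (hu r hr.1 q hq).symm, hfR r hr.1, Polynomial.eval_zero]
      · have := natDegree_restrict_le q hfd
        have := hdB q hq
        omega
  have hV : ∃ e, V e := ⟨e₀, he₀⟩
  obtain ⟨f, hf0, hfe, hf⟩ := Nat.find_spec hV
  have hmin := fun g h => Nat.find_min hV (m := g) h
  have hfd : f.totalDegree ≤ 3 * d := hfe ▸ (Nat.find_min' hV he₀).trans he₀d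
  obtain ⟨l, hl, hsing⟩ : ∃ l ∈ R ∪ B, l.restrict (dY l.u f) ≠ 0 ∨ l.restrict (dZ f) ≠ 0 := by
    by_contra! hall
    obtain ⟨l₀, hl₀⟩ := hne
    by_cases hder : ∀ i, MvPolynomial.pderiv i f = 0
    · have h1 := eq_C_of_pderiv_eq_zero (p := p) (by omega) hder
      have h2 := hf l₀ hl₀
      rw [h1, restrict_C, Polynomial.C_eq_zero] at h2
      rw [h2, map_zero] at h1
      exact hf0 h1
    · push Not at hder
      obtain ⟨i, hi⟩ := hder
      have hlt := totalDegree_pderiv_lt hi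
      rw [hfe] at hlt
      refine hmin _ hlt ⟨_, hi, rfl, fun l hl => ?_⟩
      obtain ⟨hg, hh⟩ := hall l hl
      have h2 : l.restrict (MvPolynomial.pderiv 2 f) = 0 := hh
      have h1 : l.restrict (MvPolynomial.pderiv 1 f) = 0 := by
        simpa [dY, h2] using hg
      have h0 : l.restrict (MvPolynomial.pderiv 0 f) = 0 := by
        have := derivative_restrict_pderiv l f
        rw [hf l hl, h1, h2] at this
        simpa using this.symm
      fin_cases i
      · exact h0
      · exact h1
      · exact h2
  have hfR : ∀ r ∈ R, r.restrict f = 0 := fun r hr => hf r (Finset.mem_union_left _ hr)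
  have hfB : ∀ r ∈ B, r.restrict f = 0 := fun r hr => hf r (Finset.mem_union_right _ hr)
  have e18 : 18 * d = 6 * (3 * d) := by ring
  rw [e18]
  rcases Finset.mem_union.1 hl with hl | hl
  · exact .inr (exists_removable_of_mem (p := p) hR hB hu hkB (by omega) (by nlinarith) (by omega)
      hdR hdB hfd hfR hfB hl hsing)
  · exact .inl (exists_removable_of_mem (p := p) hB hR (fun b hb r hr => (hu r hr b hb).symm) hkR
      (by omega) (by nlinarith) (by omega) hdB hdR hfd hfB hfR hl hsing)

open Classical in
/-- An incidence bound for two families of rays. -/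
theorem sum_card_cross_le {p : ℕ} [CharP K p] {R B : Finset (Ray K)} {d k : ℕ}
    (hR : ∀ q ∈ R, ∀ q' ∈ R, q ≠ q' → ¬ Cross q q') (hB : ∀ q ∈ B, ∀ q' ∈ B, q ≠ q' → ¬ Cross q q')
    (hu : ∀ r ∈ R, ∀ b ∈ B, r.u ≠ b.u)
    (hkB : ∀ q ∈ B, ∀ q' ∈ B, q ≠ q' → (R.filter fun r => Cross q r ∧ Cross q' r).card ≤ k)
    (hkR : ∀ q ∈ R, ∀ q' ∈ R, q ≠ q' → (B.filter fun r => Cross q r ∧ Cross q' r).card ≤ k)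
    (hp : 6 * d + 1 < p) (hRd : 3 * R.card < d ^ 2) (hBd : 3 * B.card < d ^ 2) :
    ∑ x ∈ R, (B.filter fun r => Cross x r).card ≤ (18 * d + k) * (R.card + B.card) := by
  induction hn : R.card + B.card using Nat.strong_induction_on generalizing R B with
  | _ n ih =>
    subst hn
    rcases (R ∪ B).eq_empty_or_nonempty with h0 | hne
    · rw [Finset.union_eq_empty] at h0
      simp [h0.1]
    rcases exists_removable (p := p) hR hB hu hkB hkR hp hRd hBd hne with
      ⟨X, hX, hX0, hXs⟩ | ⟨X, hX, hX0, hXs⟩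
    · have hc := Finset.card_sdiff_add_card_eq_card hX
      have hpos := hX0.card_pos
      have hs : R \ X ⊆ R := Finset.sdiff_subset
      have := ih ((R \ X).card + B.card) (by omega) (R := R \ X) (B := B)
        (fun q hq q' hq' => hR q (hs hq) q' (hs hq')) hB (fun r hr => hu r (hs hr))
        (fun q hq q' hq' h => (Finset.card_le_card (Finset.filter_subset_filter _ hs)).trans
          (hkB q hq q' hq' h))
        (fun q hq q' hq' => hkR q (hs hq) q' (hs hq')) (by omega) hBd rfl
      rw [← Finset.sum_sdiff hX, ← hc]
      nlinarith
    · have hc := Finset.card_sdiff_add_card_eq_card hX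
      have hpos := hX0.card_pos
      have hs : B \ X ⊆ B := Finset.sdiff_subset
      have := ih (R.card + (B \ X).card) (by omega) (R := R) (B := B \ X)
        hR (fun q hq q' hq' => hB q (hs hq) q' (hs hq')) (fun r hr b hb => hu r hr b (hs hb))
        (fun q hq q' hq' => hkB q (hs hq) q' (hs hq'))
        (fun q hq q' hq' h => (Finset.card_le_card (Finset.filter_subset_filter _ hs)).trans
          (hkR q hq q' hq' h)) hRd (by omega) rfl
      have hswap : ∑ x ∈ X, (R.filter fun r => Cross x r).card
          = ∑ r ∈ R, (X.filter fun x => Cross r x).card := by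
        simp only [Finset.card_filter]
        rw [Finset.sum_comm]
        exact Finset.sum_congr rfl fun r _ => Finset.sum_congr rfl fun x _ => by
          simp only [show Cross x r ↔ Cross r x from ⟨Cross.symm, Cross.symm⟩]
      have hsplit : ∀ r ∈ R, (B.filter fun b => Cross r b).card
          = ((B \ X).filter fun b => Cross r b).card + (X.filter fun b => Cross r b).card := by
        intro r _
        simp only [Finset.card_filter]
        rw [Finset.sum_sdiff hX]
      rw [Finset.sum_congr rfl hsplit, Finset.sum_add_distrib, ← hswap, ← hc]
      nlinarith

end Ray

namespace Ray

variable {F K : Type*} [Field F] [Field K]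

/-- The first family of rays attached to the equation `x * b + c = x' * b' + c'`. -/
def red (φ : F →+* K) (θ : K) (z : F × F × F) : Ray K where
  u := θ * φ z.1
  a := φ z.2.1 + θ ^ 2
  b := φ z.2.2 + θ ^ 2 * φ z.2.1 + θ * φ z.1 * (φ z.2.1 + θ ^ 2)

/-- The second family of rays attached to the equation `x * b + c = x' * b' + c'`. -/
def blue (φ : F →+* K) (θ : K) (y : F × F × F) : Ray K where
  u := φ y.2.1 + θ ^ 2
  a := φ y.1 / θ
  b := φ y.2.2 - θ ^ 2 * φ y.2.1 - θ ^ 4 + (φ y.2.1 + θ ^ 2) * (φ y.1 / θ)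

theorem cross_red_blue (φ : F →+* K) {θ : K} (hθ : θ ≠ 0) (z y : F × F × F) :
    Cross (red φ θ z) (blue φ θ y) ↔ z.1 * y.1 + z.2.2 = y.2.1 * z.2.1 + y.2.2 := by
  have h : Cross (red φ θ z) (blue φ θ y) ↔
      φ (z.1 * y.1 + z.2.2) = φ (y.2.1 * z.2.1 + y.2.2) := by
    simp only [Cross, red, blue, map_add, map_mul]
    field_simp
    constructor
    · intro h
      apply mul_left_cancel₀ hθ
      linear_combination h
    · intro h
      linear_combination θ * h
  rw [h]
  exact φ.injective.eq_iff

/-- No nontrivial cubic polynomial with coefficients in `F` vanishes at `θ`. -/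
def NoCubic (φ : F →+* K) (θ : K) : Prop :=
  ∀ c₀ c₁ c₂ c₃ : F, φ c₀ + φ c₁ * θ + φ c₂ * θ ^ 2 + φ c₃ * θ ^ 3 = 0 →
    c₀ = 0 ∧ c₁ = 0 ∧ c₂ = 0 ∧ c₃ = 0

theorem NoCubic.ne_zero {φ : F →+* K} {θ : K} (h : NoCubic φ θ) : θ ≠ 0 := by
  rintro rfl
  simpa using h 0 1 0 0

theorem NoCubic.eq_of_cross_red {φ : F →+* K} {θ : K} (h : NoCubic φ θ) {z z' : F × F × F}
    (hc : Cross (red φ θ z) (red φ θ z')) : z = z' := by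
  simp only [Cross, red] at hc
  obtain ⟨h0, -, h2, h3⟩ := h (z.2.2 - z'.2.2) (z.1 * z'.2.1 - z'.1 * z.2.1) (z.2.1 - z'.2.1)
    (z.1 - z'.1) (by
      simp only [map_sub, map_mul]
      linear_combination hc)
  exact Prod.ext (sub_eq_zero.1 h3) (Prod.ext (sub_eq_zero.1 h2) (sub_eq_zero.1 h0))

theorem NoCubic.eq_of_cross_blue {φ : F →+* K} {θ : K} (h : NoCubic φ θ) {z z' : F × F × F}
    (hc : Cross (blue φ θ z) (blue φ θ z')) : z = z' := by
  have hθ := h.ne_zero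
  simp only [Cross, blue] at hc
  field_simp at hc
  obtain ⟨-, h1, h2, h3⟩ := h (z.2.1 * z'.1 - z.1 * z'.2.1) (z.2.2 - z'.2.2) (z'.1 - z.1)
    (z'.2.1 - z.2.1) (by
      simp only [map_sub, map_mul]
      linear_combination hc)
  exact Prod.ext (sub_eq_zero.1 h2).symm (Prod.ext (sub_eq_zero.1 h3).symm (sub_eq_zero.1 h1))

theorem NoCubic.u_ne {φ : F →+* K} {θ : K} (h : NoCubic φ θ) (z y : F × F × F) :
    (red φ θ z).u ≠ (blue φ θ y).u := by
  intro hc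
  simp only [red, blue] at hc
  have := h (-y.2.1) z.1 (-1) 0 (by
    simp only [map_neg, map_one, map_zero]
    linear_combination hc)
  exact one_ne_zero (neg_eq_zero.1 this.2.2.1)

open Classical in
theorem card_common_le (P D A : Finset F) (Y : F × F × F → F × F × F → Prop)
    (hY : ∀ z y, Y z y ↔ z.1 * y.1 + z.2.2 = y.2.1 * z.2.1 + y.2.2) {k : ℕ} (hP : P.card ≤ k)
    (hD : D.card ≤ k) {y y' : F × F × F} (hy : y ≠ y') :
    ((P ×ˢ D ×ˢ A).filter fun z => Y z y ∧ Y z y').card ≤ k := by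
  by_cases hs : y.2.1 = y'.2.1
  · by_cases hr : y.1 = y'.1
    · rw [Finset.filter_false_of_mem]
      · simp
      · rintro z - ⟨h1, h2⟩
        rw [hY] at h1 h2
        apply hy
        refine Prod.ext hr (Prod.ext hs ?_)
        rw [hr, hs] at h1
        linear_combination h2 - h1
    · refine (Finset.card_le_card_of_injOn (fun z => z.2.1) (t := D) ?_ ?_).trans hD
      · intro z hz
        simp only [Finset.coe_filter, Finset.mem_product, Set.mem_ofPred_eq] at hz
        exact hz.1.2.1
      · intro z hz w hw (h : z.2.1 = w.2.1)
        simp only [Finset.coe_filter, Finset.mem_product, Set.mem_ofPred_eq, hY] at hz hw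
        obtain ⟨-, hz1, hz2⟩ := hz
        obtain ⟨-, hw1, hw2⟩ := hw
        rw [hs] at hz1 hw1
        have h1 : z.1 = w.1 := by
          apply mul_right_cancel₀ (sub_ne_zero.2 hr)
          linear_combination hz1 - hz2 - hw1 + hw2
        refine Prod.ext h1 (Prod.ext h ?_)
        rw [h1, h] at hz1
        linear_combination hz1 - hw1
  · refine (Finset.card_le_card_of_injOn (fun z => z.1) (t := P) ?_ ?_).trans hP
    · intro z hz
      simp only [Finset.coe_filter, Finset.mem_product, Set.mem_ofPred_eq] at hz
      exact hz.1.1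
    · intro z hz w hw (h : z.1 = w.1)
      simp only [Finset.coe_filter, Finset.mem_product, Set.mem_ofPred_eq, hY] at hz hw
      obtain ⟨-, hz1, hz2⟩ := hz
      obtain ⟨-, hw1, hw2⟩ := hw
      rw [h] at hz1 hz2
      have h1 : z.2.1 = w.2.1 := by
        apply mul_left_cancel₀ (sub_ne_zero.2 hs)
        linear_combination hz2 - hz1 + hw1 - hw2
      refine Prod.ext h (Prod.ext h1 ?_)
      rw [h1] at hz1
      linear_combination hz1 - hw1

open Classical in
theorem sum_card_solutions_le_of_noCubic {φ : F →+* K} {θ : K} (h : NoCubic φ θ) {p : ℕ}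
    [CharP K p] {P D A : Finset F} {d k : ℕ} (hp : 6 * d + 1 < p)
    (hd : 3 * (P.card * D.card * A.card) < d ^ 2) (hP : P.card ≤ k) (hD : D.card ≤ k) :
    ∑ z ∈ P ×ˢ D ×ˢ A,
      ((D ×ˢ P ×ˢ A).filter fun y => z.1 * y.1 + z.2.2 = y.2.1 * z.2.1 + y.2.2).card
      ≤ (18 * d + k) * (2 * (P.card * D.card * A.card)) := by
  have hθ := h.ne_zero
  have refl : ∀ q : Ray K, Cross q q := fun q => by simp [Cross]
  have ir : Function.Injective (red φ θ) := fun z z' hz => h.eq_of_cross_red (hz ▸ refl _)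
  have ib : Function.Injective (blue φ θ) := fun z z' hz => h.eq_of_cross_blue (hz ▸ refl _)
  have key := sum_card_cross_le (p := p) (R := (P ×ˢ D ×ˢ A).image (red φ θ))
    (B := (D ×ˢ P ×ˢ A).image (blue φ θ)) (d := d) (k := k) ?_ ?_ ?_ ?_ ?_ hp ?_ ?_
  · rw [Finset.sum_image ir.injOn, Finset.card_image_of_injective _ ir,
      Finset.card_image_of_injective _ ib] at key
    simp only [Finset.filter_image, Finset.card_image_of_injective _ ib, cross_red_blue φ hθ,
      Finset.card_product] at key
    calc _ ≤ _ := key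
      _ = _ := by ring
  · intro q hq q' hq' hne hc
    simp only [Finset.mem_image] at hq hq'
    obtain ⟨z, -, rfl⟩ := hq
    obtain ⟨z', -, rfl⟩ := hq'
    exact hne (congrArg _ (h.eq_of_cross_red hc))
  · intro q hq q' hq' hne hc
    simp only [Finset.mem_image] at hq hq'
    obtain ⟨z, -, rfl⟩ := hq
    obtain ⟨z', -, rfl⟩ := hq'
    exact hne (congrArg _ (h.eq_of_cross_blue hc))
  · intro q hq q' hq'
    simp only [Finset.mem_image] at hq hq'
    obtain ⟨z, -, rfl⟩ := hq
    obtain ⟨z', -, rfl⟩ := hq'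
    exact h.u_ne _ _
  · intro q hq q' hq' hne
    simp only [Finset.mem_image] at hq hq'
    obtain ⟨y, -, rfl⟩ := hq
    obtain ⟨y', -, rfl⟩ := hq'
    rw [Finset.filter_image]
    refine Finset.card_image_le.trans ?_
    exact card_common_le P D A (fun z y => Cross (blue φ θ y) (red φ θ z))
      (fun z y => by rw [← cross_red_blue φ hθ]; exact ⟨Cross.symm, Cross.symm⟩) hP hD
      (fun hh => hne (congrArg _ hh))
  · intro q hq q' hq' hne
    simp only [Finset.mem_image] at hq hq'
    obtain ⟨y, -, rfl⟩ := hq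
    obtain ⟨y', -, rfl⟩ := hq'
    rw [Finset.filter_image]
    refine Finset.card_image_le.trans ?_
    have hinj : Function.Injective fun z : F × F × F => (z.2.1, z.1, z.2.2) := by
      rintro ⟨a, b, c⟩ ⟨a', b', c'⟩ hh
      simp only [Prod.mk.injEq] at hh ⊢
      tauto
    refine (Finset.card_le_card_of_injOn (fun z => (z.2.1, z.1, z.2.2)) ?_ hinj.injOn).trans
      (card_common_le P D A (fun z y => z.1 * y.1 + z.2.2 = y.2.1 * z.2.1 + y.2.2)
        (fun z y => Iff.rfl) hP hD (y := (y.2.1, y.1, y.2.2)) (y' := (y'.2.1, y'.1, y'.2.2))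
        fun hh => hne (congrArg _ (hinj hh)))
    intro z hz
    simp only [Finset.coe_filter, Finset.mem_product, Set.mem_ofPred_eq,
      cross_red_blue φ hθ] at hz ⊢
    refine ⟨⟨hz.1.2.1, hz.1.1, hz.1.2.2⟩, ?_, ?_⟩
    · linear_combination -hz.2.1
    · linear_combination -hz.2.2
  all_goals
    refine lt_of_le_of_lt (Nat.mul_le_mul_left 3 Finset.card_image_le) ?_
    simp only [Finset.card_product]
    calc _ = 3 * (P.card * D.card * A.card) := by ring
      _ < _ := hd

theorem noCubic_X (F : Type*) [Field F] :
    NoCubic ((algebraMap (Polynomial F) (FractionRing (Polynomial F))).comp Polynomial.C)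
      (algebraMap (Polynomial F) (FractionRing (Polynomial F)) Polynomial.X) := by
  intro c₀ c₁ c₂ c₃ h
  simp only [RingHom.comp_apply] at h
  rw [← map_pow, ← map_pow, ← map_mul, ← map_mul, ← map_mul, ← map_add, ← map_add, ← map_add,
    map_eq_zero_iff _ (IsFractionRing.injective _ _)] at h
  have hc := fun n => congrArg (fun P => Polynomial.coeff P n) h
  refine ⟨by simpa using hc 0, ?_, ?_, ?_⟩
  · simpa [Polynomial.coeff_X, Polynomial.coeff_C] using hc 1
  · simpa [Polynomial.coeff_X, Polynomial.coeff_C] using hc 2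
  · simpa [Polynomial.coeff_X, Polynomial.coeff_C] using hc 3

open Classical in
/-- Counting solutions of `x * b + c = x' * b' + c'` over a field of large characteristic. -/
theorem sum_card_solutions_le {p : ℕ} [CharP F p] {P D A : Finset F} {n : ℕ}
    (hP : P.card ≤ n ^ 2) (hD : D.card ≤ n) (hA : A.card ≤ n)
    (hp : 400 * (P.card * n ^ 2) ≤ p ^ 2) :
    ((∑ z ∈ P ×ˢ D ×ˢ A, ((D ×ˢ P ×ˢ A).filter
      fun y => z.1 * y.1 + z.2.2 = y.2.1 * z.2.1 + y.2.2).card : ℕ) : ℝ)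
      ≤ 120 * (√P.card * n) ^ 3 := by
  rcases P.eq_empty_or_nonempty with rfl | hP0
  · simp
  rcases Nat.eq_zero_or_pos n with rfl | hn
  · simp only [nonpos_iff_eq_zero, Finset.card_eq_zero] at hD
    simp [hD]
  have hP1 : 1 ≤ P.card := hP0.card_pos
  have : CharP (FractionRing (Polynomial F)) p :=
    charP_of_injective_algebraMap (IsFractionRing.injective (Polynomial F) _) p
  set m := P.card with hm
  set s : ℝ := √m * n with hs
  have hs2 : s ^ 2 = m * n ^ 2 := by
    rw [hs, mul_pow, Real.sq_sqrt (Nat.cast_nonneg _)]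
  have hs0 : 0 ≤ s := by positivity
  have hm1 : (1 : ℝ) ≤ √m := by
    rw [Real.one_le_sqrt]; exact_mod_cast hP1
  have hn1 : (1 : ℝ) ≤ n := by exact_mod_cast hn
  have hns : (n : ℝ) ≤ s := by rw [hs]; nlinarith
  have hms : (m : ℝ) ≤ s := by
    have h1 : √(m : ℝ) ≤ n := by
      rw [Real.sqrt_le_left (by positivity)]; exact_mod_cast hP
    have h2 : (m : ℝ) = √m * √m := (Real.mul_self_sqrt (Nat.cast_nonneg _)).symm
    calc (m : ℝ) = √m * √m := h2
      _ ≤ √m * n := by gcongr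
  set d := Nat.sqrt (3 * (m * n ^ 2)) + 1 with hd
  have hdlt : 3 * (m * n ^ 2) < d ^ 2 := by
    have := Nat.lt_succ_sqrt (3 * (m * n ^ 2))
    rw [hd, pow_two (_ + 1)]; exact this
  have hds : (d : ℝ) ≤ 3 * s := by
    have h1 : Nat.sqrt (3 * (m * n ^ 2)) ^ 2 ≤ 3 * (m * n ^ 2) := Nat.sqrt_le' _
    have h2 : ((Nat.sqrt (3 * (m * n ^ 2)) : ℕ) : ℝ) ^ 2 ≤ 3 * s ^ 2 := by
      rw [hs2]; exact_mod_cast h1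
    have h3 : ((Nat.sqrt (3 * (m * n ^ 2)) : ℕ) : ℝ) ≤ 2 * s :=
      abs_le_of_sq_le_sq' (by nlinarith) (by positivity) |>.2
    rw [hd]; push_cast; linarith
  have hps : 20 * s ≤ p := by
    have h1 : (400 : ℝ) * (m * n ^ 2) ≤ p ^ 2 := by exact_mod_cast hp
    exact abs_le_of_sq_le_sq' (by rw [← hs2] at h1; nlinarith) (by positivity) |>.2
  have key := sum_card_solutions_le_of_noCubic (noCubic_X F) (p := p) (P := P) (D := D)
    (A := A) (d := d) (k := max m n) (by
      have : ((6 * d + 1 : ℕ) : ℝ) < p := by push_cast; linarith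
      exact_mod_cast this)
    (by
      refine lt_of_le_of_lt ?_ hdlt
      rw [mul_assoc, pow_two]
      gcongr) (le_max_left _ _) (hD.trans (le_max_right _ _))
  have hcard : ((m * D.card * A.card : ℕ) : ℝ) ≤ s ^ 2 := by
    rw [hs2, mul_assoc, pow_two]
    norm_cast
    gcongr
  calc _ ≤ (((18 * d + max m n) * (2 * (m * D.card * A.card)) : ℕ) : ℝ) := Nat.cast_le.2 key
    _ = (18 * d + max (m : ℝ) n) * (2 * ((m * D.card * A.card : ℕ) : ℝ)) := by push_cast; ring
    _ ≤ (18 * (3 * s) + s) * (2 * s ^ 2) := by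
      gcongr
      exact max_le hms hns
    _ ≤ 120 * s ^ 3 := by nlinarith [pow_nonneg hs0 3]

end Ray

theorem exists_sum_div_le {n : ℕ} (hn : 1 ≤ n) {g : ℕ → ℝ} (hg : ∀ t, 0 ≤ g t) :
    ∃ t, 1 ≤ t ∧ ∑ i ∈ Finset.Icc 1 n, g i / i ≤ (1 + Real.log n) * g t := by
  obtain ⟨t, ht, hmax⟩ := Finset.exists_max_image (Finset.Icc 1 n) g ⟨1, by simpa using hn⟩
  refine ⟨t, (Finset.mem_Icc.1 ht).1, ?_⟩
  have hh : ∑ i ∈ Finset.Icc 1 n, (i : ℝ)⁻¹ ≤ 1 + Real.log n := by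
    have := harmonic_le_one_add_log n
    rw [harmonic_eq_sum_Icc] at this
    push_cast at this
    exact this
  calc ∑ i ∈ Finset.Icc 1 n, g i / i ≤ ∑ i ∈ Finset.Icc 1 n, (i : ℝ)⁻¹ * g t := by
        refine Finset.sum_le_sum fun i hi => ?_
        rw [div_eq_inv_mul]
        exact mul_le_mul_of_nonneg_left (hmax i hi) (by positivity)
    _ = (∑ i ∈ Finset.Icc 1 n, (i : ℝ)⁻¹) * g t := by rw [Finset.sum_mul]
    _ ≤ _ := mul_le_mul_of_nonneg_right hh (hg t)

theorem sum_Icc_ite_le {m n : ℕ} (h : m ≤ n) (w : ℕ → ℝ) :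
    ∑ t ∈ Finset.Icc 1 n, (if t ≤ m then w t else 0) = ∑ t ∈ Finset.Icc 1 m, w t := by
  rw [← Finset.sum_filter]
  congr 1
  ext t
  simp only [Finset.mem_filter, Finset.mem_Icc]
  omega

theorem sum_sum_Icc_eq {ι : Type*} (s : Finset ι) {f : ι → ℕ} {n : ℕ} (hf : ∀ i ∈ s, f i ≤ n)
    (w : ℕ → ℝ) : ∑ i ∈ s, ∑ t ∈ Finset.Icc 1 (f i), w t
      = ∑ t ∈ Finset.Icc 1 n, w t * (s.filter fun i => t ≤ f i).card := by
  rw [Finset.sum_congr rfl fun i hi => (sum_Icc_ite_le (hf i hi) w).symm, Finset.sum_comm]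
  refine Finset.sum_congr rfl fun t _ => ?_
  rw [← Finset.sum_filter, Finset.sum_const, nsmul_eq_mul, mul_comm]

/-- Up to a logarithmic factor, a sum is dominated by one of its level sets. -/
theorem exists_level {ι : Type*} (s : Finset ι) {f : ι → ℕ} {n : ℕ} (hn : 1 ≤ n)
    (hf : ∀ i ∈ s, f i ≤ n) : ∃ t : ℕ, 1 ≤ t ∧
      ((∑ i ∈ s, f i : ℕ) : ℝ) ≤ (1 + Real.log n) * (t * (s.filter fun i => t ≤ f i).card) := by
  obtain ⟨t, ht, h⟩ := exists_sum_div_le hn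
    (g := fun t => t * ((s.filter fun i => t ≤ f i).card : ℝ)) (fun t => by positivity)
  refine ⟨t, ht, le_trans (le_of_eq ?_) h⟩
  have h1 := sum_sum_Icc_eq s hf (fun _ => 1)
  simp only [Finset.sum_const, Nat.card_Icc, add_tsub_cancel_right, nsmul_eq_mul, mul_one,
    one_mul] at h1
  rw [Nat.cast_sum, h1]
  refine Finset.sum_congr rfl fun i hi => ?_
  have : (i : ℝ) ≠ 0 := by have := (Finset.mem_Icc.1 hi).1; positivity
  field_simp

/-- Up to a logarithmic factor, a sum of squares is dominated by one of its level sets. -/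
theorem exists_level_sq {ι : Type*} (s : Finset ι) {f : ι → ℕ} {n : ℕ} (hn : 1 ≤ n)
    (hf : ∀ i ∈ s, f i ≤ n) : ∃ t : ℕ, 1 ≤ t ∧ ((∑ i ∈ s, f i ^ 2 : ℕ) : ℝ)
      ≤ (1 + Real.log n) * (2 * t ^ 2 * (s.filter fun i => t ≤ f i).card) := by
  obtain ⟨t, ht, h⟩ := exists_sum_div_le hn
    (g := fun t => 2 * t ^ 2 * ((s.filter fun i => t ≤ f i).card : ℝ)) (fun t => by positivity)
  refine ⟨t, ht, le_trans ?_ h⟩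
  have h1 := sum_sum_Icc_eq s hf (fun t => 2 * t)
  have h2 : ∀ m : ℕ, (m : ℝ) ^ 2 ≤ ∑ t ∈ Finset.Icc 1 m, 2 * (t : ℝ) := by
    intro m
    induction m with
    | zero => simp
    | succ m ih =>
      rw [Finset.sum_Icc_succ_top (by omega)]
      push_cast
      linarith
  calc ((∑ i ∈ s, f i ^ 2 : ℕ) : ℝ) = ∑ i ∈ s, (f i : ℝ) ^ 2 := by push_cast; rfl
    _ ≤ _ := Finset.sum_le_sum fun i _ => h2 (f i)
    _ = _ := h1
    _ = _ := by
      refine Finset.sum_congr rfl fun i hi => ?_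
      have : (i : ℝ) ≠ 0 := by have := (Finset.mem_Icc.1 hi).1; positivity
      field_simp

section Energy

variable {F : Type*} [Field F] [DecidableEq F]

theorem addEnergy_union_le [Fintype F] {A B X : Finset F} (h : Disjoint A B) {L : ℝ} (hL : 0 ≤ L)
    (hA : (A.addEnergy X : ℝ) ≤ (L * A.card) ^ 2) (hB : (B.addEnergy X : ℝ) ≤ (L * B.card) ^ 2) :
    ((A ∪ B).addEnergy X : ℝ) ≤ (L * (A ∪ B).card) ^ 2 := by
  rw [Finset.addEnergy_eq_sum_sq] at hA hB ⊢
  push_cast at hA hB ⊢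
  set r : Finset F → F → ℝ := fun S a => ((S ×ˢ X).filter fun ab => ab.1 + ab.2 = a).card with hr
  have hadd : ∀ a, r (A ∪ B) a = r A a + r B a := by
    intro a
    simp only [hr]
    rw [Finset.union_product, Finset.filter_union, Finset.card_union_of_disjoint]
    · push_cast; rfl
    · refine Finset.disjoint_filter_filter ?_
      rw [Finset.disjoint_product]
      exact .inl h
  change ∑ a, r (A ∪ B) a ^ 2 ≤ _
  have hA' : ∑ a, r A a ^ 2 ≤ (L * A.card) ^ 2 := hA
  have hB' : ∑ a, r B a ^ 2 ≤ (L * B.card) ^ 2 := hB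
  have hcs := Finset.sum_mul_sq_le_sq_mul_sq Finset.univ (r A) (r B)
  have h0 : 0 ≤ ∑ a, r A a * r B a := Finset.sum_nonneg fun _ _ => by positivity
  have hm : ∑ a, r A a * r B a ≤ (L * A.card) * (L * B.card) := by
    refine abs_le_of_sq_le_sq' (hcs.trans ?_) (by positivity) |>.2
    rw [mul_pow]
    exact mul_le_mul hA' hB' (Finset.sum_nonneg fun _ _ => by positivity) (by positivity)
  rw [Finset.card_union_of_disjoint h]
  push_cast
  have : ∑ a, r (A ∪ B) a ^ 2 = ∑ a, r A a ^ 2 + 2 * ∑ a, r A a * r B a + ∑ a, r B a ^ 2 := by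
    rw [Finset.mul_sum, ← Finset.sum_add_distrib, ← Finset.sum_add_distrib]
    refine Finset.sum_congr rfl fun a _ => ?_
    rw [hadd]; ring
  rw [this]
  nlinarith

/-- The number of representations of `x` as a ratio of elements of `D`. -/
def ratioCount (D : Finset F) (x : F) : ℕ := ((D ×ˢ D).filter fun ab => ab.1 = x * ab.2).card

theorem ratioCount_le (D : Finset F) (x : F) : ratioCount D x ≤ D.card := by
  refine Finset.card_le_card_of_injOn Prod.snd ?_ ?_
  · intro z hz
    simp only [Finset.coe_filter, Finset.mem_product, Set.mem_ofPred_eq] at hz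
    exact hz.1.2
  · intro z hz w hw (h : z.2 = w.2)
    simp only [Finset.coe_filter, Finset.mem_product, Set.mem_ofPred_eq] at hz hw
    exact Prod.ext (by rw [hz.2, hw.2, h]) h

theorem sum_ratioCount_le (D S : Finset F) (h0 : (0 : F) ∉ D) :
    ∑ x ∈ S, ratioCount D x ≤ D.card ^ 2 := by
  rw [pow_two, ← Finset.card_product]
  refine le_trans ?_ (Finset.card_filter_le (D ×ˢ D) fun ab => ab.1 / ab.2 ∈ S)
  rw [Finset.card_eq_sum_card_fiberwise (f := fun ab : F × F => ab.1 / ab.2) (t := S)]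
  · refine Finset.sum_le_sum fun x hx => Finset.card_le_card fun z hz => ?_
    rw [Finset.mem_filter, Finset.mem_product] at hz
    have hz0 : z.2 ≠ 0 := fun h => h0 (h ▸ hz.1.2)
    have hzx : z.1 / z.2 = x := by rw [hz.2]; field_simp
    rw [Finset.mem_filter, Finset.mem_filter, Finset.mem_product, hzx]
    exact ⟨⟨hz.1, hx⟩, rfl⟩
  · intro z hz
    exact (Finset.mem_filter.1 hz).2

theorem mulEnergy_le_sum_ratioCount_sq [Fintype F] (D : Finset F) (h0 : (0 : F) ∉ D) :
    D.mulEnergy D ≤ ∑ x, ratioCount D x ^ 2 := by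
  rw [Finset.mulEnergy, Finset.card_eq_sum_card_fiberwise
    (f := fun q : (F × F) × F × F => q.1.1 / q.1.2) (t := Finset.univ) (by simp)]
  refine Finset.sum_le_sum fun x _ => ?_
  rw [pow_two, ratioCount, ← Finset.card_product]
  refine Finset.card_le_card_of_injOn (fun q => (q.1, q.2.2, q.2.1)) ?_ ?_
  · intro q hq
    simp only [Finset.coe_filter, Finset.mem_filter, Finset.mem_product, Set.mem_ofPred_eq,
      Finset.coe_product, Set.mem_prod] at hq ⊢
    obtain ⟨⟨⟨h1, h2⟩, h3⟩, h4⟩ := hq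
    have hz0 : q.1.2 ≠ 0 := fun h => h0 (h ▸ h1.2)
    refine ⟨⟨h1, ?_⟩, ⟨h2.2, h2.1⟩, ?_⟩
    · rw [← h4]; field_simp
    · rw [← h4]; field_simp; rw [h3, mul_comm]
  · rintro ⟨a, b, c⟩ - ⟨a', b', c'⟩ - h
    simp only [Prod.mk.injEq] at h ⊢
    tauto

theorem sq_mul_addEnergy_le {P D A A' : Finset F} {t : ℕ}
    (ht : ∀ a ∈ A', t ≤ ((P ×ˢ D).filter fun z => z.1 * z.2 = a).card) :
    t ^ 2 * A'.addEnergy A ≤ ∑ z ∈ P ×ˢ D ×ˢ A,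
      ((D ×ˢ P ×ˢ A).filter fun y => z.1 * y.1 + z.2.2 = y.2.1 * z.2.1 + y.2.2).card := by
  set Q := ((A' ×ˢ A') ×ˢ A ×ˢ A).filter fun x => x.1.1 + x.2.1 = x.1.2 + x.2.2 with hQ
  set fib : F → Finset (F × F) := fun a => (P ×ˢ D).filter fun z => z.1 * z.2 = a with hfib
  have h1 : t ^ 2 * A'.addEnergy A ≤ (Q.sigma fun q => fib q.1.1 ×ˢ fib q.1.2).card := by
    rw [Finset.card_sigma, Finset.addEnergy, mul_comm, ← smul_eq_mul]
    refine Finset.card_nsmul_le_sum _ _ _ fun q hq => ?_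
    rw [Finset.mem_filter, Finset.mem_product, Finset.mem_product] at hq
    rw [Finset.card_product, pow_two]
    exact Nat.mul_le_mul (ht _ hq.1.1.1) (ht _ hq.1.1.2)
  refine h1.trans ?_
  rw [← Finset.card_sigma]
  refine Finset.card_le_card_of_injOn (fun w => ⟨(w.2.1.1, w.2.2.2, w.1.2.1),
    (w.2.1.2, w.2.2.1, w.1.2.2)⟩) ?_ ?_
  · rintro ⟨q, z, y⟩ hw
    simp only [Finset.coe_sigma, Set.mem_sigma_iff, hQ, hfib, Finset.coe_filter,
      Finset.mem_product, Set.mem_ofPred_eq, Finset.coe_product, Set.mem_prod] at hw ⊢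
    obtain ⟨⟨⟨h2, h3⟩, h4⟩, ⟨h5, h6⟩, h7, h8⟩ := hw
    refine ⟨⟨h5.1, h7.2, h3.1⟩, ⟨h5.2, h7.1, h3.2⟩, ?_⟩
    rw [h6, h8, h4]
  · rintro ⟨⟨⟨a, a'⟩, c, c'⟩, ⟨x, b⟩, x', b'⟩ hw ⟨⟨⟨e, e'⟩, g, g'⟩, ⟨y, d⟩, y', d'⟩ hv h
    simp only [Finset.coe_sigma, Set.mem_sigma_iff, hQ, hfib, Finset.coe_filter,
      Finset.mem_product, Set.mem_ofPred_eq, Finset.coe_product, Set.mem_prod] at hw hv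
    simp only [Sigma.mk.injEq, Prod.mk.injEq, heq_eq_eq] at h
    obtain ⟨⟨rfl, rfl, rfl⟩, rfl, rfl, rfl⟩ := h
    obtain ⟨-, ⟨-, rfl⟩, -, rfl⟩ := hw
    obtain ⟨-, ⟨-, rfl⟩, -, rfl⟩ := hv
    rfl

end Energy

section Decomposition

variable {F : Type*} [Field F] [DecidableEq F]

theorem sum_ratioCount_le_sum_card (P D : Finset F) :
    ∑ x ∈ P, ratioCount D x ≤ ∑ a ∈ D, ((P ×ˢ D).filter fun z => z.1 * z.2 = a).card := by
  unfold ratioCount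
  rw [← Finset.card_sigma, ← Finset.card_sigma]
  refine Finset.card_le_card_of_injOn (fun w => ⟨w.2.1, w.1, w.2.2⟩) ?_ ?_
  · rintro ⟨x, a, b⟩ hw
    simp only [Finset.coe_sigma, Set.mem_sigma_iff, Finset.coe_filter, Finset.mem_product,
      Set.mem_ofPred_eq, Finset.mem_coe] at hw ⊢
    exact ⟨hw.2.1.1, ⟨hw.1, hw.2.1.2⟩, hw.2.2.symm⟩
  · rintro ⟨x, a, b⟩ - ⟨x', a', b'⟩ - h
    simp only [Sigma.mk.injEq, Prod.mk.injEq, heq_eq_eq] at h ⊢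
    tauto

theorem card_filter_mul_eq_le {P D : Finset F} (h0 : (0 : F) ∉ D) (a : F) :
    ((P ×ˢ D).filter fun z => z.1 * z.2 = a).card ≤ D.card := by
  refine Finset.card_le_card_of_injOn Prod.snd ?_ ?_
  · intro z hz
    simp only [Finset.coe_filter, Finset.mem_product, Set.mem_ofPred_eq] at hz
    exact hz.1.2
  · intro z hz w hw (h : z.2 = w.2)
    simp only [Finset.coe_filter, Finset.mem_product, Set.mem_ofPred_eq] at hz hw
    have hz0 : z.2 ≠ 0 := fun h => h0 (h ▸ hz.1.2)
    refine Prod.ext (mul_right_cancel₀ hz0 ?_) h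
    rw [hz.2, h, hw.2]

/-- A set of large multiplicative energy contains a piece with small additive energy. -/
theorem exists_addEnergy_le [Fintype F] {p : ℕ} [CharP F p] {A D : Finset F} (hDA : D ⊆ A)
    (h0 : (0 : F) ∉ A) {m : ℝ} (hm0 : 0 < m) (hm : m ^ 5 = A.card) (hp : m ^ 16 ≤ (p : ℝ) ^ 2)
    (hn : 1 ≤ A.card) (hX : 800 * (1 + Real.log A.card) * m ^ 14 < D.mulEnergy D) :
    ∃ A' ⊆ D, A'.Nonempty ∧
      (A'.addEnergy A : ℝ) ≤ ((1 + Real.log A.card) * m ^ 2 * A'.card) ^ 2 := by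
  set n := A.card with hn_def
  set H := 1 + Real.log n with hH
  have hH0 : 0 < H := by
    have := Real.log_natCast_nonneg n
    rw [hH]; linarith
  have hD0 : (0 : F) ∉ D := fun h => h0 (hDA h)
  have hDn : D.card ≤ n := Finset.card_le_card hDA
  obtain ⟨Δ, hΔ1, hΔ⟩ := exists_level_sq Finset.univ hn
    (f := ratioCount D) (fun x _ => (ratioCount_le D x).trans hDn)
  set P := Finset.univ.filter fun x => Δ ≤ ratioCount D x with hP
  have hY : 400 * m ^ 14 < Δ ^ 2 * P.card := by
    have h1 : (D.mulEnergy D : ℝ) ≤ ((∑ x, ratioCount D x ^ 2 : ℕ) : ℝ) := by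
      exact_mod_cast mulEnergy_le_sum_ratioCount_sq D hD0
    have h2 := hX.trans_le (h1.trans hΔ)
    refine lt_of_mul_lt_mul_left (a := 2 * H) ?_ (by positivity)
    linarith
  have hPr : P.card * Δ ≤ ∑ x ∈ P, ratioCount D x := by
    rw [← smul_eq_mul]
    exact Finset.card_nsmul_le_sum _ _ _ fun x hx => (Finset.mem_filter.1 hx).2
  have hPΔ : P.card * Δ ≤ n ^ 2 := hPr.trans ((sum_ratioCount_le D P hD0).trans (by gcongr))
  have hΔ1' : (1 : ℝ) ≤ Δ := by exact_mod_cast hΔ1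
  have hPΔ' : (P.card : ℝ) * Δ ≤ m ^ 10 := by
    have : (P.card : ℝ) * Δ ≤ (n : ℝ) ^ 2 := by exact_mod_cast hPΔ
    rw [← hm] at this
    linarith [this, show (m ^ 5) ^ 2 = m ^ 10 by ring]
  have hPn : P.card ≤ n ^ 2 := (Nat.le_mul_of_pos_right _ hΔ1).trans hPΔ
  have hΔm : 400 * m ^ 4 ≤ Δ := by
    refine le_of_mul_le_mul_left (a := m ^ 10) ?_ (by positivity)
    have : (Δ : ℝ) * (P.card * Δ) ≤ Δ * m ^ 10 := by gcongr
    nlinarith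
  have hPc : 400 * (P.card : ℝ) ≤ m ^ 6 := by
    refine le_of_mul_le_mul_left (a := m ^ 4) ?_ (by positivity)
    have : (P.card : ℝ) * (400 * m ^ 4) ≤ P.card * Δ := by gcongr
    nlinarith
  have hPp : 400 * (P.card * n ^ 2) ≤ p ^ 2 := by
    have : (400 * (P.card * n ^ 2) : ℝ) ≤ (p : ℝ) ^ 2 := by
      rw [← hm]
      refine le_trans ?_ hp
      have := mul_le_mul_of_nonneg_right hPc (by positivity : 0 ≤ m ^ 10)
      nlinarith
    exact_mod_cast this
  obtain ⟨t, ht1, ht⟩ := exists_level D hn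
    (f := fun a => ((P ×ˢ D).filter fun z => z.1 * z.2 = a).card)
    (fun a _ => (card_filter_mul_eq_le hD0 a).trans hDn)
  set A' := D.filter fun a => t ≤ ((P ×ˢ D).filter fun z => z.1 * z.2 = a).card with hA'
  have hlow : (P.card : ℝ) * Δ ≤ H * (t * A'.card) := by
    refine le_trans ?_ ht
    exact_mod_cast hPr.trans (sum_ratioCount_le_sum_card P D)
  have hPpos : 0 < (P.card : ℝ) := by
    by_contra! h
    have : (P.card : ℝ) = 0 := le_antisymm h (by positivity)
    rw [this, mul_zero] at hY
    exact absurd hY (by push Not; positivity)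
  have ht0 : 0 < (t : ℝ) := by exact_mod_cast ht1
  refine ⟨A', Finset.filter_subset _ _, ?_, ?_⟩
  · rw [← Finset.card_pos]
    by_contra! h
    have h' : A'.card = 0 := by omega
    rw [h'] at hlow
    have : 0 < (P.card : ℝ) * Δ := by positivity
    simp at hlow
    linarith
  · have h1 := sq_mul_addEnergy_le (P := P) (D := D) (A := A) (A' := A') (t := t)
      fun a ha => (Finset.mem_filter.1 ha).2
    have h2 := Ray.sum_card_solutions_le (p := p) hPn hDn le_rfl hPp
    have h3 : (t : ℝ) ^ 2 * A'.addEnergy A ≤ 120 * (√P.card * n) ^ 3 := by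
      refine le_trans ?_ h2
      exact_mod_cast h1.trans (le_of_eq (by congr!))
    set s := √(P.card : ℝ) with hs
    have hs0 : 0 < s := Real.sqrt_pos.2 hPpos
    have hs2 : s ^ 2 = P.card := Real.sq_sqrt hPpos.le
    have h4 : 20 * m ^ 7 ≤ s * Δ := by
      refine abs_le_of_sq_le_sq' ?_ (by positivity) |>.2
      rw [mul_pow, mul_pow, hs2]
      nlinarith
    have h5 : 120 * m ^ 11 ≤ s * Δ ^ 2 := by
      have := mul_le_mul h4 hΔm (by positivity) (by positivity)
      have h6 : 0 < m ^ 11 := by positivity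
      nlinarith
    refine le_of_mul_le_mul_left (a := (t : ℝ) ^ 2) ?_ (by positivity)
    calc (t : ℝ) ^ 2 * A'.addEnergy A ≤ 120 * (s * n) ^ 3 := h3
      _ = m ^ 4 * s ^ 3 * (120 * m ^ 11) := by rw [← hm]; ring
      _ ≤ m ^ 4 * s ^ 3 * (s * Δ ^ 2) := by gcongr
      _ = m ^ 4 * (P.card * Δ) ^ 2 := by rw [← hs2]; ring
      _ ≤ m ^ 4 * (H * (t * A'.card)) ^ 2 := by gcongr
      _ = _ := by ring

/-- Every set splits into a part of small additive energy and one of small multiplicative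
energy. -/
theorem exists_energy_decomposition [Fintype F] {p : ℕ} [CharP F p] {A : Finset F}
    (h0 : (0 : F) ∉ A) {m : ℝ} (hm0 : 0 < m) (hm : m ^ 5 = A.card) (hp : m ^ 16 ≤ (p : ℝ) ^ 2)
    (hn : 1 ≤ A.card) : ∃ C ⊆ A,
      (C.addEnergy C : ℝ) ≤ 800 * (1 + Real.log A.card) ^ 2 * m ^ 14 ∧
      ((A \ C).mulEnergy (A \ C) : ℝ) ≤ 800 * (1 + Real.log A.card) ^ 2 * m ^ 14 := by
  have hH : 1 ≤ 1 + Real.log A.card := by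
    have := Real.log_natCast_nonneg A.card
    linarith
  obtain ⟨C, hC, hmax⟩ := Finset.exists_max_image
    (A.powerset.filter fun C => (C.addEnergy A : ℝ) ≤
      ((1 + Real.log A.card) * m ^ 2 * C.card) ^ 2) Finset.card
    ⟨∅, Finset.mem_filter.2 ⟨Finset.empty_mem_powerset _, by
      rw [Finset.addEnergy_empty_left]; simp⟩⟩
  rw [Finset.mem_filter, Finset.mem_powerset] at hC
  refine ⟨C, hC.1, ?_, ?_⟩
  · have h1 : C.addEnergy C ≤ C.addEnergy A := Finset.addEnergy_mono_right hC.1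
    have h2 : (C.card : ℝ) ≤ m ^ 5 := by
      rw [hm]
      exact_mod_cast Finset.card_le_card hC.1
    calc (C.addEnergy C : ℝ) ≤ C.addEnergy A := by exact_mod_cast h1
      _ ≤ ((1 + Real.log A.card) * m ^ 2 * C.card) ^ 2 := hC.2
      _ ≤ ((1 + Real.log A.card) * m ^ 2 * m ^ 5) ^ 2 := by gcongr
      _ = (1 + Real.log A.card) ^ 2 * m ^ 14 := by ring
      _ ≤ _ := by
        have : 0 ≤ (1 + Real.log A.card) ^ 2 * m ^ 14 := by positivity
        linarith
  · by_contra! h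
    have hlt : 800 * (1 + Real.log A.card) * m ^ 14 < (A \ C).mulEnergy (A \ C) := by
      refine lt_of_le_of_lt ?_ h
      gcongr
      nlinarith
    obtain ⟨A', hA', hne, hE⟩ :=
      exists_addEnergy_le Finset.sdiff_subset h0 hm0 hm hp hn hlt
    have hdisj : Disjoint C A' := Finset.disjoint_of_subset_right hA' Finset.disjoint_sdiff
    have h1 := addEnergy_union_le hdisj (by positivity) hC.2 hE
    have h2 := hmax (C ∪ A') (by
      rw [Finset.mem_filter, Finset.mem_powerset]
      exact ⟨Finset.union_subset hC.1 (hA'.trans Finset.sdiff_subset), h1⟩)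
    rw [Finset.card_union_of_disjoint hdisj] at h2
    have := hne.card_pos
    omega

end Decomposition

section Hashing

variable {q : ℕ} [Fact q.Prime]

theorem val_add_val_eq {x y z w : ZMod q} (hx : 2 * x.val < q) (hy : 2 * y.val < q)
    (hz : 2 * z.val < q) (hw : 2 * w.val < q) (h : x + y = z + w) :
    x.val + y.val = z.val + w.val := by
  rw [← ZMod.val_add_of_lt (by omega), ← ZMod.val_add_of_lt (a := z) (by omega), h]

theorem le_two_mul_card_val_lt (u : ZMod q) :
    q ≤ 2 * (Finset.univ.filter fun l : ZMod q => 2 * (l * u).val < q).card := by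
  have hq := (Fact.out : q.Prime).pos
  by_cases hu : u = 0
  · subst hu
    rw [Finset.filter_true_of_mem (by intro x _; simpa using hq), Finset.card_univ, ZMod.card]
    omega
  · have h1 : (Finset.range ((q + 1) / 2)).card
        ≤ (Finset.univ.filter fun l : ZMod q => 2 * (l * u).val < q).card := by
      refine Finset.card_le_card_of_injOn (fun i => (i : ZMod q) * u⁻¹) ?_ ?_
      · intro i hi
        rw [Finset.mem_coe, Finset.mem_range] at hi
        rw [Finset.mem_coe, Finset.mem_filter]
        refine ⟨Finset.mem_univ _, ?_⟩
        rw [inv_mul_cancel_right₀ hu, ZMod.val_cast_of_lt (by omega)]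
        omega
      · intro i hi j hj h
        rw [Finset.mem_coe, Finset.mem_range] at hi hj
        have h2 := congrArg ZMod.val (mul_right_cancel₀ (inv_ne_zero hu) h)
        rwa [ZMod.val_cast_of_lt (by omega), ZMod.val_cast_of_lt (by omega)] at h2
    rw [Finset.card_range] at h1
    omega

theorem mul_card_collision_le {u v : ZMod q} (huv : u ≠ v) {r : ℕ} (hr : 0 < r) (hrq : r ≤ q) :
    r * (Finset.univ.filter fun l : ZMod q => 2 * (l * u).val < q ∧ 2 * (l * v).val < q ∧
      (((l * u).val : ℕ) : ZMod r) = ((l * v).val : ℕ)).card ≤ 2 * q := by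
  have h1 : (Finset.univ.filter fun l : ZMod q => 2 * (l * u).val < q ∧ 2 * (l * v).val < q ∧
      (((l * u).val : ℕ) : ZMod r) = ((l * v).val : ℕ)).card
      ≤ (Finset.Icc (-((q / (2 * r) : ℕ) : ℤ)) ((q / (2 * r) : ℕ) : ℤ)).card := by
    refine Finset.card_le_card_of_injOn
      (fun l => (((l * u).val : ℤ) - ((l * v).val : ℤ)) / r) ?_ ?_
    · intro l hl
      simp only [Finset.coe_filter, Finset.mem_univ, true_and, Set.mem_ofPred_eq] at hl
      obtain ⟨ha, hb, hc⟩ := hl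
      have hd : (r : ℤ) ∣ ((l * u).val : ℤ) - ((l * v).val : ℤ) := by
        rw [← ZMod.intCast_zmod_eq_zero_iff_dvd]
        push_cast
        rw [hc, sub_self]
      obtain ⟨k, hk⟩ := hd
      rw [Finset.mem_coe, Finset.mem_Icc]
      simp only [hk]
      have hr' : (0 : ℤ) < r := by exact_mod_cast hr
      rw [Int.mul_ediv_cancel_left _ hr'.ne']
      push_cast
      have hk1 : k ≤ (q : ℤ) / (2 * r) := by
        rw [Int.le_ediv_iff_mul_le (by positivity)]
        nlinarith
      have hk2 : -k ≤ (q : ℤ) / (2 * r) := by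
        rw [Int.le_ediv_iff_mul_le (by positivity)]
        nlinarith
      constructor <;> linarith
    · intro l hl l' hl' h
      simp only [Finset.coe_filter, Finset.mem_univ, true_and, Set.mem_ofPred_eq] at hl hl'
      have hd : ∀ l : ZMod q, (((l * u).val : ℕ) : ZMod r) = ((l * v).val : ℕ) →
          (r : ℤ) ∣ ((l * u).val : ℤ) - ((l * v).val : ℤ) := by
        intro l hc
        rw [← ZMod.intCast_zmod_eq_zero_iff_dvd]
        push_cast
        rw [hc, sub_self]
      have h2 := (Int.ediv_left_inj (hd l hl.2.2) (hd l' hl'.2.2)).1 h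
      have h3 := congrArg (Int.cast : ℤ → ZMod q) h2
      push_cast at h3
      simp only [ZMod.natCast_val, ZMod.cast_id', id_eq, ← mul_sub] at h3
      exact mul_right_cancel₀ (sub_ne_zero.2 huv) h3
  have h2 : (Finset.Icc (-((q / (2 * r) : ℕ) : ℤ)) ((q / (2 * r) : ℕ) : ℤ)).card
      = 2 * (q / (2 * r)) + 1 := by
    rw [Int.card_Icc]; omega
  have h3 := Nat.div_mul_le_self q (2 * r)
  rw [h2] at h1
  nlinarith

end Hashing

/-- A random dilation modulo a large prime, followed by reduction modulo `r`, respects sums on a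
positive proportion of a set and makes few pairs collide. -/
theorem exists_hash {α : Type*} [DecidableEq α] {B : Finset α} {ψ : α → ℕ}
    (hψ : Set.InjOn ψ B) {r : ℕ} (hr : 0 < r) {E : Finset (α × α)}
    (hE : ∀ e ∈ E, e.1 ∈ B ∧ e.2 ∈ B ∧ e.1 ≠ e.2) :
    ∃ B' ⊆ B, ∃ φ : α → ℕ,
      (∀ a ∈ B', ∀ b ∈ B', ∀ c ∈ B', ∀ d ∈ B', ψ a + ψ b = ψ c + ψ d → φ a + φ b = φ c + φ d) ∧
      B.card ≤ 4 * B'.card ∧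
      r * (E.filter fun e => (e.1 ∈ B' ∧ e.2 ∈ B') ∧ (φ e.1 : ZMod r) = φ e.2).card
        ≤ 8 * E.card := by
  obtain ⟨q, hq1, hq⟩ := Nat.exists_infinite_primes (max r (B.sup ψ) + 1)
  have : Fact q.Prime := ⟨hq⟩
  have hrq : r ≤ q := by have := le_max_left r (B.sup ψ); omega
  have hψq : ∀ x ∈ B, ψ x < q := by
    intro x hx
    have h1 := le_max_right r (B.sup ψ)
    have h2 := Finset.le_sup (f := ψ) hx
    omega
  have hψne : ∀ x ∈ B, ∀ y ∈ B, x ≠ y → (ψ x : ZMod q) ≠ ψ y := by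
    intro x hx y hy hxy h
    have h2 := congrArg ZMod.val h
    rw [ZMod.val_cast_of_lt (hψq x hx), ZMod.val_cast_of_lt (hψq y hy)] at h2
    exact hxy (hψ hx hy h2)
  set V : ZMod q → Finset α := fun l => B.filter fun x => 2 * (l * (ψ x : ZMod q)).val < q with hV
  set φ : ZMod q → α → ℕ := fun l x => (l * (ψ x : ZMod q)).val with hφ
  have hfre : ∀ l, ∀ a ∈ V l, ∀ b ∈ V l, ∀ c ∈ V l, ∀ d ∈ V l, ψ a + ψ b = ψ c + ψ d →
      φ l a + φ l b = φ l c + φ l d := by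
    intro l a ha b hb c hc d hd h
    refine val_add_val_eq (Finset.mem_filter.1 ha).2 (Finset.mem_filter.1 hb).2
      (Finset.mem_filter.1 hc).2 (Finset.mem_filter.1 hd).2 ?_
    rw [← mul_add, ← mul_add]
    congr 1
    exact_mod_cast congrArg (Nat.cast : ℕ → ZMod q) h
  rcases E.eq_empty_or_nonempty with rfl | hEne
  · refine ⟨V 0, Finset.filter_subset _ _, φ 0, hfre 0, ?_, by simp⟩
    rw [hV]
    simp only [zero_mul, ZMod.val_zero, mul_zero]
    rw [Finset.filter_true_of_mem fun _ _ => hq.pos]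
    omega
  · set c : ZMod q → ℕ := fun l =>
      (E.filter fun e => (e.1 ∈ V l ∧ e.2 ∈ V l) ∧ (φ l e.1 : ZMod r) = φ l e.2).card with hc
    have hBpos : 0 < B.card := by
      obtain ⟨e, he⟩ := hEne
      exact Finset.card_pos.2 ⟨e.1, (hE e he).1⟩
    have hEpos := hEne.card_pos
    have hsumV : B.card * q ≤ 2 * ∑ l, (V l).card := by
      have : ∑ l, (V l).card = ∑ x ∈ B,
          (Finset.univ.filter fun l : ZMod q => 2 * (l * (ψ x : ZMod q)).val < q).card :=
        Finset.sum_card_bipartiteAbove_eq_sum_card_bipartiteBelow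
          (fun (l : ZMod q) x => 2 * (l * (ψ x : ZMod q)).val < q)
      rw [this, Finset.mul_sum, ← smul_eq_mul]
      exact Finset.card_nsmul_le_sum _ _ _ fun x _ => le_two_mul_card_val_lt _
    have hsumc : r * ∑ l, c l ≤ E.card * (2 * q) := by
      have : ∑ l, c l = ∑ e ∈ E, (Finset.univ.filter fun l : ZMod q =>
          (e.1 ∈ V l ∧ e.2 ∈ V l) ∧ (φ l e.1 : ZMod r) = φ l e.2).card :=
        Finset.sum_card_bipartiteAbove_eq_sum_card_bipartiteBelow
          (fun (l : ZMod q) (e : α × α) =>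
            (e.1 ∈ V l ∧ e.2 ∈ V l) ∧ (φ l e.1 : ZMod r) = φ l e.2)
      rw [this, Finset.mul_sum, ← smul_eq_mul]
      refine Finset.sum_le_card_nsmul _ _ _ fun e he => ?_
      obtain ⟨h1, h2, h3⟩ := hE e he
      refine le_trans (Nat.mul_le_mul le_rfl (Finset.card_le_card ?_))
        (mul_card_collision_le (hψne _ h1 _ h2 h3) hr hrq)
      intro l hl
      simp only [Finset.mem_filter, Finset.mem_univ, true_and, hV] at hl ⊢
      exact ⟨hl.1.1.2, hl.1.2.2, hl.2⟩
    obtain ⟨l, -, hl⟩ := Finset.exists_le_of_sum_le (s := (Finset.univ : Finset (ZMod q)))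
      (f := fun _ => 2 * (E.card : ℤ) * B.card)
      (g := fun l => 8 * (E.card : ℤ) * (V l).card - r * B.card * c l)
      Finset.univ_nonempty (by
        rw [Finset.sum_const, Finset.card_univ, ZMod.card, Finset.sum_sub_distrib,
          ← Finset.mul_sum, ← Finset.mul_sum, nsmul_eq_mul]
        zify at hsumV hsumc
        have e1 := mul_le_mul_of_nonneg_left hsumV (by positivity : (0 : ℤ) ≤ 4 * E.card)
        have e2 := mul_le_mul_of_nonneg_left hsumc (by positivity : (0 : ℤ) ≤ B.card)
        linarith)
    have hVB : (V l).card ≤ B.card := Finset.card_filter_le _ _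
    refine ⟨V l, Finset.filter_subset _ _, φ l, hfre l, ?_, ?_⟩
    · have h1 : 2 * (E.card : ℤ) * B.card ≤ 8 * E.card * (V l).card := by
        have : (0 : ℤ) ≤ r * B.card * c l := by positivity
        linarith
      have h2 : (2 * E.card) * B.card ≤ (2 * E.card) * (4 * (V l).card) := by
        zify; linarith
      exact Nat.le_of_mul_le_mul_left h2 (by omega)
    · have h1 : (r : ℤ) * B.card * c l ≤ 8 * E.card * (V l).card := by
        have : (0 : ℤ) ≤ 2 * (E.card : ℤ) * B.card := by positivity
        linarith
      have h2 : B.card * (r * c l) ≤ B.card * (8 * E.card) := by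
        have : (8 * E.card : ℤ) * (V l).card ≤ 8 * E.card * B.card := by gcongr
        zify; linarith
      exact Nat.le_of_mul_le_mul_left h2 hBpos

theorem exists_hash_pair {α : Type*} [DecidableEq α] {B : Finset α} {ψ : α → ℕ}
    (hψ : Set.InjOn ψ B) {r : ℕ} (hr : 0 < r) :
    ∃ B' ⊆ B, ∃ φ : α → ZMod r × ZMod r,
      (∀ a ∈ B', ∀ b ∈ B', ∀ c ∈ B', ∀ d ∈ B', ψ a + ψ b = ψ c + ψ d → φ a + φ b = φ c + φ d) ∧
      B.card ≤ 16 * B'.card ∧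
      r ^ 2 * (B'.offDiag.filter fun e => φ e.1 = φ e.2).card ≤ 64 * B.card ^ 2 := by
  obtain ⟨B₁, hB₁, φ₁, hφ₁, hc₁, he₁⟩ := exists_hash hψ hr (E := B.offDiag) (by
    intro e he
    simpa using he)
  obtain ⟨B₂, hB₂, φ₂, hφ₂, hc₂, he₂⟩ := exists_hash (hψ.mono (Finset.coe_subset.2 hB₁)) hr
    (E := B.offDiag.filter fun e => (e.1 ∈ B₁ ∧ e.2 ∈ B₁) ∧ (φ₁ e.1 : ZMod r) = φ₁ e.2) (by
      intro e he
      simp only [Finset.mem_filter, Finset.mem_offDiag] at he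
      exact ⟨he.2.1.1, he.2.1.2, he.1.2.2⟩)
  refine ⟨B₂, hB₂.trans hB₁, fun x => (φ₁ x, φ₂ x), ?_, by omega, ?_⟩
  · intro a ha b hb c hc d hd h
    have h1 := hφ₁ a (hB₂ ha) b (hB₂ hb) c (hB₂ hc) d (hB₂ hd) h
    have h2 := hφ₂ a ha b hb c hc d hd h
    refine Prod.ext ?_ ?_
    · have := congrArg (Nat.cast : ℕ → ZMod r) h1
      push_cast at this
      exact this
    · have := congrArg (Nat.cast : ℕ → ZMod r) h2
      push_cast at this
      exact this
  · have h1 : (B₂.offDiag.filter fun e => ((φ₁ e.1 : ZMod r), (φ₂ e.1 : ZMod r)) =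
          ((φ₁ e.2 : ZMod r), (φ₂ e.2 : ZMod r)))
        ⊆ ((B.offDiag.filter fun e => (e.1 ∈ B₁ ∧ e.2 ∈ B₁) ∧ (φ₁ e.1 : ZMod r) = φ₁ e.2).filter
          fun e => (e.1 ∈ B₂ ∧ e.2 ∈ B₂) ∧ (φ₂ e.1 : ZMod r) = φ₂ e.2) := by
      intro e he
      simp only [Finset.mem_filter, Finset.mem_offDiag, Prod.mk.injEq] at he ⊢
      obtain ⟨⟨h1, h2, h3⟩, h4, h5⟩ := he
      exact ⟨⟨⟨hB₁ (hB₂ h1), hB₁ (hB₂ h2), h3⟩, ⟨hB₂ h1, hB₂ h2⟩, h4⟩, ⟨h1, h2⟩, h5⟩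
    have h2 := Finset.card_le_card h1
    have h3 : B.offDiag.card ≤ B.card ^ 2 := by rw [Finset.offDiag_card, pow_two]; omega
    calc _ ≤ r ^ 2 * _ := Nat.mul_le_mul le_rfl h2
      _ = r * (r * _) := by rw [pow_two, mul_assoc]
      _ ≤ r * (8 * _) := Nat.mul_le_mul le_rfl he₂
      _ = 8 * (r * _) := by ring
      _ ≤ 8 * (8 * _) := Nat.mul_le_mul le_rfl he₁
      _ ≤ _ := by omega

section Parabola

variable {K : Type*} [Field K]

/-- The affine function on the plane with coefficients `c`. -/
def affEval (c : K × K × K) (z : K × K) : K := c.1 + c.2.1 * z.1 + c.2.2 * z.2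

/-- The affine map of the plane with coefficients `θ` sends `z` to the parabola `y = x ^ 2`. -/
def OnParabola (θ : (K × K × K) × K × K × K) (z : K × K) : Prop :=
  affEval θ.2 z = affEval θ.1 z ^ 2

/-- Twice the signed area of a triangle. -/
def triDet (z₁ z₂ z₃ : K × K) : K :=
  (z₂.1 - z₁.1) * (z₃.2 - z₁.2) - (z₃.1 - z₁.1) * (z₂.2 - z₁.2)

theorem affEval_injective {z₁ z₂ z₃ : K × K} (hD : triDet z₁ z₂ z₃ ≠ 0) {c d : K × K × K}
    (h₁ : affEval c z₁ = affEval d z₁) (h₂ : affEval c z₂ = affEval d z₂)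
    (h₃ : affEval c z₃ = affEval d z₃) : c = d := by
  obtain ⟨c₀, c₁, c₂⟩ := c
  obtain ⟨d₀, d₁, d₂⟩ := d
  unfold affEval at h₁ h₂ h₃
  simp only at h₁ h₂ h₃
  have e₁ : c₁ = d₁ := by
    refine mul_left_cancel₀ hD ?_
    unfold triDet
    linear_combination (z₃.2 - z₁.2) * (h₂ - h₁) - (z₂.2 - z₁.2) * (h₃ - h₁)
  have e₂ : c₂ = d₂ := by
    refine mul_left_cancel₀ hD ?_
    unfold triDet
    linear_combination (z₂.1 - z₁.1) * (h₃ - h₁) - (z₃.1 - z₁.1) * (h₂ - h₁)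
  subst e₁ e₂
  have e₀ : c₀ = d₀ := by linear_combination h₁
  rw [e₀]

theorem eq_of_onParabola {z₁ z₂ z₃ : K × K} (hD : triDet z₁ z₂ z₃ ≠ 0)
    {θ η : (K × K × K) × K × K × K}
    (hθ₁ : OnParabola θ z₁) (hθ₂ : OnParabola θ z₂) (hθ₃ : OnParabola θ z₃)
    (hη₁ : OnParabola η z₁) (hη₂ : OnParabola η z₂) (hη₃ : OnParabola η z₃)
    (h₁ : affEval θ.1 z₁ = affEval η.1 z₁) (h₂ : affEval θ.1 z₂ = affEval η.1 z₂)
    (h₃ : affEval θ.1 z₃ = affEval η.1 z₃) : θ = η := by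
  refine Prod.ext (affEval_injective hD h₁ h₂ h₃) (affEval_injective hD ?_ ?_ ?_)
  · rw [hθ₁, hη₁, h₁]
  · rw [hθ₂, hη₂, h₂]
  · rw [hθ₃, hη₃, h₃]

theorem triDet_ne_zero {z₁ z₂ z₃ : K × K} {θ : (K × K × K) × K × K × K}
    (hθ₁ : OnParabola θ z₁) (hθ₂ : OnParabola θ z₂) (hθ₃ : OnParabola θ z₃)
    (h₁₂ : affEval θ.1 z₁ ≠ affEval θ.1 z₂) (h₁₃ : affEval θ.1 z₁ ≠ affEval θ.1 z₃)
    (h₂₃ : affEval θ.1 z₂ ≠ affEval θ.1 z₃) : triDet z₁ z₂ z₃ ≠ 0 := by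
  intro hD
  have h : (affEval θ.1 z₂ - affEval θ.1 z₁) * (affEval θ.1 z₃ - affEval θ.1 z₁) *
      (affEval θ.1 z₃ - affEval θ.1 z₂)
      = (θ.1.2.1 * θ.2.2.2 - θ.1.2.2 * θ.2.2.1) * triDet z₁ z₂ z₃ := by
    have e : (affEval θ.1 z₂ - affEval θ.1 z₁) * (affEval θ.2 z₃ - affEval θ.2 z₁) -
        (affEval θ.1 z₃ - affEval θ.1 z₁) * (affEval θ.2 z₂ - affEval θ.2 z₁)
        = (θ.1.2.1 * θ.2.2.2 - θ.1.2.2 * θ.2.2.1) * triDet z₁ z₂ z₃ := by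
      unfold affEval triDet; ring
    rw [hθ₁, hθ₂, hθ₃] at e
    rw [← e]; ring
  rw [hD, mul_zero] at h
  simp only [mul_eq_zero, sub_eq_zero] at h
  rcases h with (h | h) | h
  · exact h₁₂ h.symm
  · exact h₁₃ h.symm
  · exact h₂₃ h.symm

theorem card_quadratic_roots_le [DecidableEq K] {a b c : K} (ha : a ≠ 0) {s : Finset K}
    (hs : ∀ x ∈ s, a * x ^ 2 + b * x + c = 0) : s.card ≤ 2 := by
  by_contra! h
  obtain ⟨x, hx, y, hy, z, hz, hxy, hxz, hyz⟩ := Finset.two_lt_card.1 h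
  have h1 := hs x hx
  have h2 := hs y hy
  have h3 := hs z hz
  have e1 : a * (x + y) + b = 0 := by
    refine mul_left_cancel₀ (sub_ne_zero.2 hxy) ?_
    linear_combination h1 - h2
  have e2 : a * (x + z) + b = 0 := by
    refine mul_left_cancel₀ (sub_ne_zero.2 hxz) ?_
    linear_combination h1 - h3
  have e3 : a * (y - z) = 0 := by linear_combination e1 - e2
  rcases mul_eq_zero.1 e3 with h | h
  · exact ha h
  · exact hyz (sub_eq_zero.1 h)

variable [Fintype K] [DecidableEq K]

instance (θ : (K × K × K) × K × K × K) (z : K × K) : Decidable (OnParabola θ z) :=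
  inferInstanceAs (Decidable (affEval θ.2 z = affEval θ.1 z ^ 2))

theorem card_onParabola (z : K × K) :
    (Finset.univ.filter fun θ : (K × K × K) × K × K × K => OnParabola θ z).card
      = Fintype.card K ^ 5 := by
  have h : (Finset.univ : Finset ((K × K × K) × K × K)).card = Fintype.card K ^ 5 := by
    rw [Finset.card_univ]
    simp only [Fintype.card_prod]
    ring
  rw [← h]
  refine Finset.card_bij (fun θ _ => (θ.1, θ.2.2)) (fun _ _ => Finset.mem_univ _) ?_ ?_
  · rintro ⟨α, β₀, β₁, β₂⟩ hβ ⟨γ, δ₀, δ₁, δ₂⟩ hδ e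
    simp only [Finset.mem_filter, Finset.mem_univ, true_and] at hβ hδ
    simp only [Prod.mk.injEq] at e
    obtain ⟨rfl, rfl, rfl⟩ := e
    unfold OnParabola at hβ hδ
    have e2 := hβ.trans hδ.symm
    unfold affEval at e2
    simp only [add_left_inj] at e2
    rw [e2]
  · rintro ⟨α, β₁, β₂⟩ -
    refine ⟨(α, affEval α z ^ 2 - β₁ * z.1 - β₂ * z.2, β₁, β₂), ?_, rfl⟩
    simp only [Finset.mem_filter, Finset.mem_univ, true_and]
    unfold OnParabola
    simp only [affEval]
    ring

theorem card_onParabola_collision_le {z w : K × K} (hzw : z ≠ w) :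
    (Finset.univ.filter fun θ : (K × K × K) × K × K × K => OnParabola θ z ∧ OnParabola θ w ∧
      affEval θ.1 z = affEval θ.1 w).card ≤ Fintype.card K ^ 3 := by
  have h : (Finset.univ : Finset (K × K × K)).card = Fintype.card K ^ 3 := by
    rw [Finset.card_univ]
    simp only [Fintype.card_prod]
    ring
  obtain ⟨u, v⟩ := z
  obtain ⟨u', v'⟩ := w
  rw [← h]
  have key : ∀ θ : (K × K × K) × K × K × K, OnParabola θ (u, v) → OnParabola θ (u', v') →
      affEval θ.1 (u, v) = affEval θ.1 (u', v') →
      affEval θ.2 (u, v) = affEval θ.2 (u', v') := by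
    intro θ h1 h2 h3
    rw [h1, h2, h3]
  by_cases hu : u = u'
  · subst hu
    have hv : v - v' ≠ 0 := fun e => hzw (by rw [sub_eq_zero.1 e])
    have key2 : ∀ c : K × K × K, affEval c (u, v) = affEval c (u, v') → c.2.2 = 0 := by
      intro c hc
      unfold affEval at hc
      refine mul_left_cancel₀ hv ?_
      linear_combination hc
    refine Finset.card_le_card_of_injOn (fun θ => (θ.1.1, θ.1.2.1, θ.2.2.1))
      (fun _ _ => Finset.mem_coe.2 (Finset.mem_univ _)) ?_
    rintro ⟨⟨α₀, α₁, α₂⟩, β₀, β₁, β₂⟩ hβ ⟨⟨γ₀, γ₁, γ₂⟩, δ₀, δ₁, δ₂⟩ hδ e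
    simp only [Finset.coe_filter, Finset.mem_univ, true_and, Set.mem_ofPred_eq] at hβ hδ
    simp only [Prod.mk.injEq] at e
    obtain ⟨rfl, rfl, rfl⟩ := e
    have e1 : α₂ = 0 := key2 _ hβ.2.2
    have e2 : γ₂ = 0 := key2 _ hδ.2.2
    have e3 : β₂ = 0 := key2 _ (key _ hβ.1 hβ.2.1 hβ.2.2)
    have e4 : δ₂ = 0 := key2 _ (key _ hδ.1 hδ.2.1 hδ.2.2)
    subst e1 e2 e3 e4
    have e5 := hβ.1.trans hδ.1.symm
    unfold affEval at e5
    simp only [add_left_inj] at e5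
    rw [e5]
  · have hu' : u - u' ≠ 0 := sub_ne_zero.2 hu
    have key2 : ∀ c d : K × K × K, affEval c (u, v) = affEval c (u', v') →
        affEval d (u, v) = affEval d (u', v') → c.2.2 = d.2.2 → c.2.1 = d.2.1 := by
      intro c d hc hd h
      unfold affEval at hc hd
      simp only at hc hd
      refine mul_left_cancel₀ hu' ?_
      rw [h] at hc
      linear_combination hc - hd
    refine Finset.card_le_card_of_injOn (fun θ => (θ.1.1, θ.1.2.2, θ.2.2.2))
      (fun _ _ => Finset.mem_coe.2 (Finset.mem_univ _)) ?_
    rintro ⟨⟨α₀, α₁, α₂⟩, β₀, β₁, β₂⟩ hβ ⟨⟨γ₀, γ₁, γ₂⟩, δ₀, δ₁, δ₂⟩ hδ e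
    simp only [Finset.coe_filter, Finset.mem_univ, true_and, Set.mem_ofPred_eq] at hβ hδ
    simp only [Prod.mk.injEq] at e
    obtain ⟨rfl, rfl, rfl⟩ := e
    have e1 : α₁ = γ₁ := key2 _ _ hβ.2.2 hδ.2.2 rfl
    have e2 : β₁ = δ₁ := key2 _ _ (key _ hβ.1 hβ.2.1 hβ.2.2) (key _ hδ.1 hδ.2.1 hδ.2.2) rfl
    subst e1 e2
    have e5 := hβ.1.trans hδ.1.symm
    unfold affEval at e5
    simp only [add_left_inj] at e5
    rw [e5]

theorem card_onParabola_triple_le (z₁ z₂ z₃ : K × K) :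
    (Finset.univ.filter fun θ : (K × K × K) × K × K × K =>
      (OnParabola θ z₁ ∧ OnParabola θ z₂ ∧ OnParabola θ z₃) ∧
      affEval θ.1 z₁ ≠ affEval θ.1 z₂ ∧ affEval θ.1 z₁ ≠ affEval θ.1 z₃ ∧
      affEval θ.1 z₂ ≠ affEval θ.1 z₃).card ≤ Fintype.card K ^ 3 := by
  have h : (Finset.univ : Finset (K × K × K)).card = Fintype.card K ^ 3 := by
    rw [Finset.card_univ]
    simp only [Fintype.card_prod]
    ring
  rw [← h]
  refine Finset.card_le_card_of_injOn
    (fun θ => (affEval θ.1 z₁, affEval θ.1 z₂, affEval θ.1 z₃))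
    (fun _ _ => Finset.mem_coe.2 (Finset.mem_univ _)) ?_
  intro θ hθ η hη e
  simp only [Finset.coe_filter, Finset.mem_univ, true_and, Set.mem_ofPred_eq] at hθ hη
  simp only [Prod.mk.injEq] at e
  obtain ⟨⟨h1, h2, h3⟩, h4, h5, h6⟩ := hθ
  exact eq_of_onParabola (triDet_ne_zero h1 h2 h3 h4 h5 h6) h1 h2 h3 hη.1.1 hη.1.2.1 hη.1.2.2
    e.1 e.2.1 e.2.2

theorem card_onParabola_affine_le {z₁ z₂ z₃ z₄ : K × K} (hD : triDet z₁ z₂ z₃ ≠ 0) {c : K}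
    {d e : K} (hsum : c + d + e = 1) (hz₁ : c * z₁.1 + d * z₂.1 + e * z₃.1 = z₄.1)
    (hz₂ : c * z₁.2 + d * z₂.2 + e * z₃.2 = z₄.2) (hc : c * (c - 1) ≠ 0) :
    (Finset.univ.filter fun θ : (K × K × K) × K × K × K =>
      OnParabola θ z₁ ∧ OnParabola θ z₂ ∧ OnParabola θ z₃ ∧ OnParabola θ z₄).card
      ≤ 2 * Fintype.card K ^ 2 := by
  have h : (Finset.univ : Finset (K × K)).card = Fintype.card K ^ 2 := by
    rw [Finset.card_univ]
    simp only [Fintype.card_prod]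
    ring
  have haff : ∀ f : K × K × K,
      affEval f z₄ = c * affEval f z₁ + d * affEval f z₂ + e * affEval f z₃ := by
    intro f
    unfold affEval
    rw [← hz₁, ← hz₂]
    linear_combination (-f.1) * hsum
  rw [← h]
  refine Finset.card_le_mul_card_image_of_maps_to
    (f := fun θ => (affEval θ.1 z₂, affEval θ.1 z₃)) (fun _ _ => Finset.mem_univ _) _ ?_
  rintro ⟨s, t⟩ -
  set Q := (Finset.univ.filter fun θ : (K × K × K) × K × K × K =>
      OnParabola θ z₁ ∧ OnParabola θ z₂ ∧ OnParabola θ z₃ ∧ OnParabola θ z₄).filter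
      fun θ => (affEval θ.1 z₂, affEval θ.1 z₃) = (s, t) with hQ
  have hmem : ∀ θ ∈ Q, (OnParabola θ z₁ ∧ OnParabola θ z₂ ∧ OnParabola θ z₃ ∧ OnParabola θ z₄) ∧
      affEval θ.1 z₂ = s ∧ affEval θ.1 z₃ = t := by
    intro θ hθ
    simpa [hQ, Finset.mem_filter] using hθ
  have hinj : Set.InjOn (fun θ : (K × K × K) × K × K × K => affEval θ.1 z₁) Q := by
    intro θ hθ η hη h1
    obtain ⟨⟨a1, a2, a3, -⟩, a4, a5⟩ := hmem θ hθ
    obtain ⟨⟨b1, b2, b3, -⟩, b4, b5⟩ := hmem η hη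
    exact eq_of_onParabola hD a1 a2 a3 b1 b2 b3 h1 (a4.trans b4.symm) (a5.trans b5.symm)
  rw [← Finset.card_image_of_injOn hinj]
  refine card_quadratic_roots_le (a := c * (c - 1)) (b := 2 * c * (d * s + e * t))
    (c := (d * s + e * t) ^ 2 - d * s ^ 2 - e * t ^ 2) hc ?_
  intro x hx
  obtain ⟨θ, hθ, rfl⟩ := Finset.mem_image.1 hx
  obtain ⟨⟨a1, a2, a3, a6⟩, a4, a5⟩ := hmem θ hθ
  unfold OnParabola at a1 a2 a3 a6
  rw [haff, haff, a1, a2, a3, a4, a5] at a6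
  linear_combination -a6

theorem card_onParabola_quadruple_le (h2 : (2 : K) ≠ 0) (z₁ z₂ z₃ z₄ : K × K) :
    (Finset.univ.filter fun θ : (K × K × K) × K × K × K =>
      (OnParabola θ z₁ ∧ OnParabola θ z₂ ∧ OnParabola θ z₃ ∧ OnParabola θ z₄) ∧
      (affEval θ.1 z₁ ≠ affEval θ.1 z₂ ∧ affEval θ.1 z₁ ≠ affEval θ.1 z₃ ∧
      affEval θ.1 z₂ ≠ affEval θ.1 z₃) ∧ affEval θ.1 z₁ ≠ affEval θ.1 z₄ ∧
      affEval θ.1 z₂ ≠ affEval θ.1 z₄ ∧ affEval θ.1 z₃ ≠ affEval θ.1 z₄).card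
      ≤ 2 * Fintype.card K ^ 2 := by
  rcases Finset.eq_empty_or_nonempty (Finset.univ.filter fun θ : (K × K × K) × K × K × K =>
      (OnParabola θ z₁ ∧ OnParabola θ z₂ ∧ OnParabola θ z₃ ∧ OnParabola θ z₄) ∧
      (affEval θ.1 z₁ ≠ affEval θ.1 z₂ ∧ affEval θ.1 z₁ ≠ affEval θ.1 z₃ ∧
      affEval θ.1 z₂ ≠ affEval θ.1 z₃) ∧ affEval θ.1 z₁ ≠ affEval θ.1 z₄ ∧
      affEval θ.1 z₂ ≠ affEval θ.1 z₄ ∧ affEval θ.1 z₃ ≠ affEval θ.1 z₄) with hE | ⟨θ, hθ⟩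
  · rw [hE]; simp
  simp only [Finset.mem_filter, Finset.mem_univ, true_and] at hθ
  obtain ⟨⟨h1, h2', h3, h4⟩, ⟨n12, n13, n23⟩, n14, n24, n34⟩ := hθ
  have hD := triDet_ne_zero h1 h2' h3 n12 n13 n23
  have hD213 := triDet_ne_zero h2' h1 h3 n12.symm n23 n13
  have hD321 := triDet_ne_zero h3 h2' h1 n23.symm n13.symm n12.symm
  obtain ⟨c, d, e, hsum, hz₁, hz₂⟩ : ∃ c d e : K, c + d + e = 1 ∧
      c * z₁.1 + d * z₂.1 + e * z₃.1 = z₄.1 ∧ c * z₁.2 + d * z₂.2 + e * z₃.2 = z₄.2 := by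
    refine ⟨1 - triDet z₁ z₄ z₃ / triDet z₁ z₂ z₃ - triDet z₁ z₂ z₄ / triDet z₁ z₂ z₃,
      triDet z₁ z₄ z₃ / triDet z₁ z₂ z₃, triDet z₁ z₂ z₄ / triDet z₁ z₂ z₃, by ring, ?_, ?_⟩
    · field_simp
      unfold triDet
      ring
    · field_simp
      unfold triDet
      ring
  by_cases hc : c * (c - 1) = 0
  swap
  · refine (Finset.card_le_card ?_).trans (card_onParabola_affine_le hD hsum hz₁ hz₂ hc)
    intro η hη
    simp only [Finset.mem_filter, Finset.mem_univ, true_and] at hη ⊢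
    exact hη.1
  by_cases hd : d * (d - 1) = 0
  swap
  · refine (Finset.card_le_card ?_).trans (card_onParabola_affine_le (z₄ := z₄) hD213
      (c := d) (d := c) (e := e) (by linear_combination hsum) (by linear_combination hz₁)
      (by linear_combination hz₂) hd)
    intro η hη
    simp only [Finset.mem_filter, Finset.mem_univ, true_and] at hη ⊢
    tauto
  by_cases he : e * (e - 1) = 0
  swap
  · refine (Finset.card_le_card ?_).trans (card_onParabola_affine_le (z₄ := z₄) hD321
      (c := e) (d := d) (e := c) (by linear_combination hsum) (by linear_combination hz₁)
      (by linear_combination hz₂) he)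
    intro η hη
    simp only [Finset.mem_filter, Finset.mem_univ, true_and] at hη ⊢
    tauto
  exfalso
  rw [mul_eq_zero, sub_eq_zero] at hc hd he
  rcases hc with rfl | rfl <;> rcases hd with rfl | rfl <;> rcases he with rfl | rfl
  · simp at hsum
  · exact n34 (congrArg _ (Prod.ext (by simpa using hz₁) (by simpa using hz₂)))
  · exact n24 (congrArg _ (Prod.ext (by simpa using hz₁) (by simpa using hz₂)))
  · exact one_ne_zero (by linear_combination hsum : (1 : K) = 0)
  · exact n14 (congrArg _ (Prod.ext (by simpa using hz₁) (by simpa using hz₂)))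
  · exact one_ne_zero (by linear_combination hsum : (1 : K) = 0)
  · exact one_ne_zero (by linear_combination hsum : (1 : K) = 0)
  · exact h2 (by linear_combination hsum)

end Parabola

theorem eq_or_eq_of_add_eq_of_sq_add_sq_eq {K : Type*} [Field K] (h2 : (2 : K) ≠ 0)
    {a b c d : K} (h : a + b = c + d) (h' : a ^ 2 + b ^ 2 = c ^ 2 + d ^ 2) :
    (a = c ∧ b = d) ∨ (a = d ∧ b = c) := by
  have h3 : (a - c) * (a - d) = 0 := by
    refine mul_left_cancel₀ h2 ?_
    linear_combination h' + (a - b - c - d) * h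
  rcases mul_eq_zero.1 h3 with h4 | h4
  · have := sub_eq_zero.1 h4
    subst this
    exact .inl ⟨rfl, add_left_cancel h⟩
  · have := sub_eq_zero.1 h4
    subst this
    exact .inr ⟨rfl, by linear_combination h⟩

/-- A set with few coincidences for one operation contains a large subset which is Sidon both for
that operation and for one that embeds into addition of natural numbers. -/
theorem exists_sidon_subset {α : Type*} [DecidableEq α] {B : Finset α} {op : α → α → α}
    (hcomm : ∀ a b, op a b = op b a)
    (hcanc : ∀ a ∈ B, ∀ b ∈ B, ∀ c ∈ B, op a b = op a c → b = c)
    (hsq : ∀ a ∈ B, ∀ b ∈ B, op a a = op b b → a = b)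
    {ψ : α → ℕ} (hψ : Set.InjOn ψ B) {r : ℕ} (hr : r.Prime) (hr2 : r ≠ 2) {T : ℕ}
    (hT : (((B ×ˢ B) ×ˢ B ×ˢ B).filter fun x => op x.1.1 x.2.1 = op x.1.2 x.2.2).card ≤ T)
    (h1 : 4224 * B.card ≤ r ^ 2) (h2 : 128 * T ≤ r ^ 3 * B.card) :
    ∃ S ⊆ B,
      (∀ a ∈ S, ∀ b ∈ S, ∀ c ∈ S, ∀ d ∈ S, op a b = op c d →
        (a = c ∧ b = d) ∨ (a = d ∧ b = c)) ∧
      (∀ a ∈ S, ∀ b ∈ S, ∀ c ∈ S, ∀ d ∈ S, ψ a + ψ b = ψ c + ψ d →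
        (a = c ∧ b = d) ∨ (a = d ∧ b = c)) ∧
      B.card ≤ 32 * r * S.card := by
  have : Fact r.Prime := ⟨hr⟩
  obtain ⟨B', hB', φ, hφ, hcard, hcoll⟩ := exists_hash_pair hψ hr.pos
  have hK2 : (2 : ZMod r) ≠ 0 := by
    intro h
    have h3 : ((2 : ℕ) : ZMod r) = 0 := by exact_mod_cast h
    rw [ZMod.natCast_eq_zero_iff] at h3
    exact hr2 ((Nat.prime_dvd_prime_iff_eq hr Nat.prime_two).1 h3)
  let Θ := (ZMod r × ZMod r × ZMod r) × ZMod r × ZMod r × ZMod r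
  set S₀ : Θ → Finset α := fun θ => B'.filter fun x => OnParabola θ (φ x) with hS₀
  set pairs : Θ → Finset (α × α) := fun θ => B'.offDiag.filter fun e =>
    OnParabola θ (φ e.1) ∧ OnParabola θ (φ e.2) ∧
      affEval θ.1 (φ e.1) = affEval θ.1 (φ e.2) with hpairs
  set E₃ : Finset (α × α × α) := (B ×ˢ B ×ˢ B).filter fun e => op e.1 e.1 = op e.2.1 e.2.2 with hE₃
  set E₄ := ((B ×ˢ B) ×ˢ B ×ˢ B).filter fun x => op x.1.1 x.2.1 = op x.1.2 x.2.2 with hE₄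
  set triples : Θ → Finset (α × α × α) := fun θ => E₃.filter fun e =>
      (OnParabola θ (φ e.1) ∧ OnParabola θ (φ e.2.1) ∧ OnParabola θ (φ e.2.2)) ∧
      affEval θ.1 (φ e.1) ≠ affEval θ.1 (φ e.2.1) ∧ affEval θ.1 (φ e.1) ≠ affEval θ.1 (φ e.2.2) ∧
      affEval θ.1 (φ e.2.1) ≠ affEval θ.1 (φ e.2.2) with htriples
  set quads : Θ → Finset ((α × α) × α × α) := fun θ => E₄.filter fun e =>
      (OnParabola θ (φ e.1.1) ∧ OnParabola θ (φ e.1.2) ∧ OnParabola θ (φ e.2.1) ∧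
        OnParabola θ (φ e.2.2)) ∧
      (affEval θ.1 (φ e.1.1) ≠ affEval θ.1 (φ e.1.2) ∧
      affEval θ.1 (φ e.1.1) ≠ affEval θ.1 (φ e.2.1) ∧
      affEval θ.1 (φ e.1.2) ≠ affEval θ.1 (φ e.2.1)) ∧
      affEval θ.1 (φ e.1.1) ≠ affEval θ.1 (φ e.2.2) ∧
      affEval θ.1 (φ e.1.2) ≠ affEval θ.1 (φ e.2.2) ∧
      affEval θ.1 (φ e.2.1) ≠ affEval θ.1 (φ e.2.2) with hquads
  set K₂ := (B'.offDiag.filter fun e => φ e.1 = φ e.2).card with hK₂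
  have hB'c : B'.card ≤ B.card := Finset.card_le_card hB'
  have hsum₀ : ∑ θ, (S₀ θ).card = B'.card * r ^ 5 := by
    have : ∑ θ, (S₀ θ).card
        = ∑ x ∈ B', (Finset.univ.filter fun θ : Θ => OnParabola θ (φ x)).card :=
      Finset.sum_card_bipartiteAbove_eq_sum_card_bipartiteBelow
        (fun (θ : Θ) x => OnParabola θ (φ x))
    rw [this, Finset.sum_congr rfl fun x _ => card_onParabola (φ x), Finset.sum_const,
      ZMod.card, smul_eq_mul]
  have hsum₂ : ∑ θ, (pairs θ).card ≤ K₂ * r ^ 5 + B.card ^ 2 * r ^ 3 := by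
    have : ∑ θ, (pairs θ).card = ∑ e ∈ B'.offDiag, (Finset.univ.filter fun θ : Θ =>
        OnParabola θ (φ e.1) ∧ OnParabola θ (φ e.2) ∧
        affEval θ.1 (φ e.1) = affEval θ.1 (φ e.2)).card :=
      Finset.sum_card_bipartiteAbove_eq_sum_card_bipartiteBelow
        (fun (θ : Θ) (e : α × α) => OnParabola θ (φ e.1) ∧ OnParabola θ (φ e.2) ∧
          affEval θ.1 (φ e.1) = affEval θ.1 (φ e.2))
    rw [this, ← Finset.sum_filter_add_sum_filter_not _ (fun e : α × α => φ e.1 = φ e.2)]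
    refine Nat.add_le_add ?_ ?_
    · rw [hK₂, ← smul_eq_mul]
      refine Finset.sum_le_card_nsmul _ _ _ fun e _ => ?_
      refine (Finset.card_le_card ?_).trans (card_onParabola (φ e.1)).le |>.trans ?_
      · exact Finset.monotone_filter_right _ fun θ _ h => h.1
      · rw [ZMod.card]
    · refine (Finset.sum_le_card_nsmul _ _ (r ^ 3) fun e he => ?_).trans ?_
      · have := card_onParabola_collision_le (Finset.mem_filter.1 he).2
        rwa [ZMod.card] at this
      · rw [smul_eq_mul]
        refine Nat.mul_le_mul ((Finset.card_filter_le _ _).trans ?_) le_rfl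
        rw [Finset.offDiag_card, pow_two]
        exact (Nat.sub_le _ _).trans (Nat.mul_le_mul hB'c hB'c)
  have hsum₃ : ∑ θ, (triples θ).card ≤ B.card ^ 2 * r ^ 3 := by
    have : ∑ θ, (triples θ).card = ∑ e ∈ E₃, (Finset.univ.filter fun θ : Θ =>
      (OnParabola θ (φ e.1) ∧ OnParabola θ (φ e.2.1) ∧ OnParabola θ (φ e.2.2)) ∧
      affEval θ.1 (φ e.1) ≠ affEval θ.1 (φ e.2.1) ∧ affEval θ.1 (φ e.1) ≠ affEval θ.1 (φ e.2.2) ∧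
      affEval θ.1 (φ e.2.1) ≠ affEval θ.1 (φ e.2.2)).card :=
      Finset.sum_card_bipartiteAbove_eq_sum_card_bipartiteBelow
        (fun (θ : Θ) (e : α × α × α) =>
      (OnParabola θ (φ e.1) ∧ OnParabola θ (φ e.2.1) ∧ OnParabola θ (φ e.2.2)) ∧
      affEval θ.1 (φ e.1) ≠ affEval θ.1 (φ e.2.1) ∧ affEval θ.1 (φ e.1) ≠ affEval θ.1 (φ e.2.2) ∧
      affEval θ.1 (φ e.2.1) ≠ affEval θ.1 (φ e.2.2))
    rw [this]
    refine (Finset.sum_le_card_nsmul _ _ (r ^ 3) fun e he => ?_).trans ?_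
    · have := card_onParabola_triple_le (φ e.1) (φ e.2.1) (φ e.2.2)
      rwa [ZMod.card] at this
    · rw [smul_eq_mul]
      refine Nat.mul_le_mul ?_ le_rfl
      rw [pow_two, ← Finset.card_product]
      refine Finset.card_le_card_of_injOn (fun e => (e.1, e.2.1)) ?_ ?_
      · intro e he
        simp only [hE₃, Finset.coe_filter, Finset.mem_product, Set.mem_ofPred_eq] at he
        rw [Finset.mem_coe, Finset.mem_product]
        exact ⟨he.1.1, he.1.2.1⟩
      · rintro ⟨a, b, c⟩ he ⟨a', b', c'⟩ he' h
        simp only [hE₃, Finset.coe_filter, Finset.mem_product, Set.mem_ofPred_eq] at he he'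
        simp only [Prod.mk.injEq] at h
        obtain ⟨rfl, rfl⟩ := h
        rw [hcanc b he.1.2.1 c he.1.2.2 c' he'.1.2.2 (he.2.symm.trans he'.2)]
  have hsum₄ : ∑ θ, (quads θ).card ≤ T * (2 * r ^ 2) := by
    have : ∑ θ, (quads θ).card = ∑ e ∈ E₄, (Finset.univ.filter fun θ : Θ =>
      (OnParabola θ (φ e.1.1) ∧ OnParabola θ (φ e.1.2) ∧ OnParabola θ (φ e.2.1) ∧
        OnParabola θ (φ e.2.2)) ∧
      (affEval θ.1 (φ e.1.1) ≠ affEval θ.1 (φ e.1.2) ∧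
      affEval θ.1 (φ e.1.1) ≠ affEval θ.1 (φ e.2.1) ∧
      affEval θ.1 (φ e.1.2) ≠ affEval θ.1 (φ e.2.1)) ∧
      affEval θ.1 (φ e.1.1) ≠ affEval θ.1 (φ e.2.2) ∧
      affEval θ.1 (φ e.1.2) ≠ affEval θ.1 (φ e.2.2) ∧
      affEval θ.1 (φ e.2.1) ≠ affEval θ.1 (φ e.2.2)).card :=
      Finset.sum_card_bipartiteAbove_eq_sum_card_bipartiteBelow
        (fun (θ : Θ) (e : (α × α) × α × α) =>
      (OnParabola θ (φ e.1.1) ∧ OnParabola θ (φ e.1.2) ∧ OnParabola θ (φ e.2.1) ∧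
        OnParabola θ (φ e.2.2)) ∧
      (affEval θ.1 (φ e.1.1) ≠ affEval θ.1 (φ e.1.2) ∧
      affEval θ.1 (φ e.1.1) ≠ affEval θ.1 (φ e.2.1) ∧
      affEval θ.1 (φ e.1.2) ≠ affEval θ.1 (φ e.2.1)) ∧
      affEval θ.1 (φ e.1.1) ≠ affEval θ.1 (φ e.2.2) ∧
      affEval θ.1 (φ e.1.2) ≠ affEval θ.1 (φ e.2.2) ∧
      affEval θ.1 (φ e.2.1) ≠ affEval θ.1 (φ e.2.2))
    rw [this]
    refine (Finset.sum_le_card_nsmul _ _ (2 * r ^ 2) fun e he => ?_).trans ?_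
    · have := card_onParabola_quadruple_le hK2 (φ e.1.1) (φ e.1.2) (φ e.2.1) (φ e.2.2)
      rwa [ZMod.card] at this
    · rw [smul_eq_mul]
      exact Nat.mul_le_mul hT le_rfl
  obtain ⟨θ, -, hθ⟩ := Finset.exists_le_of_sum_le (s := (Finset.univ : Finset Θ))
    (f := fun _ => (B.card : ℤ))
    (g := fun θ => 32 * r * ((S₀ θ).card - (pairs θ).card - (triples θ).card - (quads θ).card))
    Finset.univ_nonempty (by
      have hΘ : (Finset.univ : Finset Θ).card = r ^ 6 := by
        rw [Finset.card_univ]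
        simp only [Θ, Fintype.card_prod, ZMod.card]
        ring
      rw [Finset.sum_const, hΘ, ← Finset.mul_sum, Finset.sum_sub_distrib, Finset.sum_sub_distrib,
        Finset.sum_sub_distrib, nsmul_eq_mul]
      zify at hsum₀ hsum₂ hsum₃ hsum₄ hcard hcoll h1 h2
      rw [hsum₀]
      have e₁ := mul_le_mul_of_nonneg_left hcard (by positivity : (0 : ℤ) ≤ 2 * r ^ 6)
      have e₂ := mul_le_mul_of_nonneg_left hsum₂ (by positivity : (0 : ℤ) ≤ 32 * r)
      have e₃ := mul_le_mul_of_nonneg_left hsum₃ (by positivity : (0 : ℤ) ≤ 32 * r)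
      have e₄ := mul_le_mul_of_nonneg_left hsum₄ (by positivity : (0 : ℤ) ≤ 32 * r)
      have e₅ := mul_le_mul_of_nonneg_left hcoll (by positivity : (0 : ℤ) ≤ 32 * r ^ 4)
      have e₆ := mul_le_mul_of_nonneg_left h1 (by positivity : (0 : ℤ) ≤ B.card * r ^ 4)
      have e₇ := mul_le_mul_of_nonneg_left h2 (by positivity : (0 : ℤ) ≤ r ^ 3)
      push_cast
      linarith)
  set S := S₀ θ \ ((pairs θ).image Prod.fst ∪ ((triples θ).image Prod.fst ∪
    (quads θ).image fun e => e.1.1)) with hS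
  have hmem : ∀ x ∈ S, x ∈ B' ∧ x ∈ B ∧ OnParabola θ (φ x) := by
    intro x hx
    have := Finset.mem_filter.1 (Finset.mem_sdiff.1 hx).1
    exact ⟨this.1, hB' this.1, this.2⟩
  have hinj : ∀ x ∈ S, ∀ y ∈ S, x ≠ y →
      affEval θ.1 (φ x) ≠ affEval θ.1 (φ y) := by
    intro x hx y hy hxy h
    refine (Finset.mem_sdiff.1 hx).2 (Finset.mem_union_left _ (Finset.mem_image.2
      ⟨(x, y), Finset.mem_filter.2 ⟨?_, (hmem x hx).2.2, (hmem y hy).2.2, h⟩, rfl⟩))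
    exact Finset.mem_offDiag.2 ⟨(hmem x hx).1, (hmem y hy).1, hxy⟩
  refine ⟨S, ?_, ?_, ?_, ?_⟩
  · exact Finset.sdiff_subset.trans ((Finset.filter_subset _ _).trans hB')
  · intro x hx y hy z hz w hw h
    have htri : ∀ x ∈ S, ∀ y ∈ S,
      ∀ z ∈ S, op x x = op y z →
        x = y ∧ x = z := by
      intro x hx y hy z hz h
      have hxB := (hmem x hx).2.1
      have hyB := (hmem y hy).2.1
      have hzB := (hmem z hz).2.1
      by_cases hxy : x = y
      · subst hxy
        exact ⟨rfl, hcanc x hxB x hxB z hzB h⟩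
      by_cases hxz : x = z
      · subst hxz
        exact absurd (hcanc x hxB x hxB y hyB (h.trans (hcomm _ _))) hxy
      by_cases hyz : y = z
      · subst hyz
        exact absurd (hsq x hxB y hyB h) hxy
      exfalso
      refine (Finset.mem_sdiff.1 hx).2 (Finset.mem_union_right _ (Finset.mem_union_left _
        (Finset.mem_image.2 ⟨(x, y, z), Finset.mem_filter.2 ⟨Finset.mem_filter.2 ⟨?_, h⟩,
          ⟨(hmem x hx).2.2, (hmem y hy).2.2, (hmem z hz).2.2⟩, hinj x hx y hy hxy,
          hinj x hx z hz hxz, hinj y hy z hz hyz⟩, rfl⟩)))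
      rw [Finset.mem_product, Finset.mem_product]
      exact ⟨hxB, hyB, hzB⟩
    have hxB := (hmem x hx).2.1
    have hyB := (hmem y hy).2.1
    have hzB := (hmem z hz).2.1
    have hwB := (hmem w hw).2.1
    by_cases hxy : x = y
    · subst hxy
      exact .inl (htri x hx z hz w hw h)
    by_cases hzw : z = w
    · subst hzw
      obtain ⟨h3, h4⟩ := htri z hz x hx y hy h.symm
      exact .inl ⟨h3.symm, h4.symm⟩
    by_cases hxz : x = z
    · subst hxz
      exact .inl ⟨rfl, hcanc x hxB y hyB w hwB h⟩
    by_cases hxw : x = w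
    · subst hxw
      exact .inr ⟨rfl, hcanc x hxB y hyB z hzB (h.trans (hcomm _ _))⟩
    by_cases hyz : y = z
    · subst hyz
      exact absurd (hcanc y hyB x hxB w hwB ((hcomm _ _).trans h)) hxw
    by_cases hyw : y = w
    · subst hyw
      exact absurd (hcanc y hyB x hxB z hzB ((hcomm _ _).trans (h.trans (hcomm _ _)))) hxz
    exfalso
    refine (Finset.mem_sdiff.1 hx).2 (Finset.mem_union_right _ (Finset.mem_union_right _
      (Finset.mem_image.2 ⟨((x, z), y, w), Finset.mem_filter.2 ⟨Finset.mem_filter.2 ⟨?_, h⟩,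
        ⟨(hmem x hx).2.2, (hmem z hz).2.2, (hmem y hy).2.2, (hmem w hw).2.2⟩,
        ⟨hinj x hx z hz hxz, hinj x hx y hy hxy, hinj z hz y hy (Ne.symm hyz)⟩,
        hinj x hx w hw hxw, hinj z hz w hw hzw, hinj y hy w hw hyw⟩, rfl⟩)))
    simp only [Finset.mem_product]
    exact ⟨⟨hxB, hzB⟩, hyB, hwB⟩
  · intro x hx y hy z hz w hw h
    have h3 := hφ x (hmem x hx).1 y (hmem y hy).1 z (hmem z hz).1 w (hmem w hw).1 h
    have h4 : ∀ c : ZMod r × ZMod r × ZMod r, affEval c (φ x) + affEval c (φ y)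
        = affEval c (φ z) + affEval c (φ w) := by
      intro c
      have h5 := congrArg Prod.fst h3
      have h6 := congrArg Prod.snd h3
      simp only [Prod.fst_add, Prod.snd_add] at h5 h6
      unfold affEval
      linear_combination c.2.1 * h5 + c.2.2 * h6
    have h5 := h4 θ.2
    rw [(hmem x hx).2.2, (hmem y hy).2.2, (hmem z hz).2.2, (hmem w hw).2.2] at h5
    have hinj' : ∀ x ∈ S, ∀ y ∈ S, affEval θ.1 (φ x) = affEval θ.1 (φ y) → x = y := by
      intro x hx y hy h
      by_contra hxy
      exact hinj x hx y hy hxy h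
    rcases eq_or_eq_of_add_eq_of_sq_add_sq_eq hK2 (h4 θ.1) h5 with h6 | h6
    · exact .inl ⟨hinj' x hx z hz h6.1, hinj' y hy w hw h6.2⟩
    · exact .inr ⟨hinj' x hx w hw h6.1, hinj' y hy z hz h6.2⟩
  · have h3 := Finset.le_card_sdiff ((pairs θ).image Prod.fst ∪ ((triples θ).image Prod.fst ∪
      (quads θ).image fun e => e.1.1)) (S₀ θ)
    rw [← hS] at h3
    have h4 := Finset.card_union_le ((pairs θ).image Prod.fst) ((triples θ).image Prod.fst ∪
      (quads θ).image fun e => e.1.1)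
    have h5 := Finset.card_union_le ((triples θ).image Prod.fst)
      ((quads θ).image fun e => e.1.1)
    have h6 : ((pairs θ).image Prod.fst).card ≤ (pairs θ).card := Finset.card_image_le
    have h7 : ((triples θ).image Prod.fst).card ≤ (triples θ).card := Finset.card_image_le
    have h8 : ((quads θ).image fun e => e.1.1).card ≤ (quads θ).card := Finset.card_image_le
    have h9 : ((S₀ θ).card : ℤ) - (pairs θ).card - (triples θ).card - (quads θ).card
        ≤ S.card := by omega
    zify
    exact hθ.trans (mul_le_mul_of_nonneg_left h9 (by positivity))

theorem exists_sidon_subset_of_card_le {α : Type*} [DecidableEq α] {B : Finset α}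
    {op : α → α → α} (hcomm : ∀ a b, op a b = op b a)
    (hcanc : ∀ a ∈ B, ∀ b ∈ B, ∀ c ∈ B, op a b = op a c → b = c)
    (hsq : ∀ a ∈ B, ∀ b ∈ B, op a a = op b b → a = b)
    {ψ : α → ℕ} (hψ : Set.InjOn ψ B) {m H : ℝ} (hm : 1 ≤ m) (hH : 1 ≤ H)
    (hB₁ : (B.card : ℝ) ≤ m ^ 5) (hB₂ : m ^ 5 ≤ 2 * B.card)
    (hE : ((((B ×ˢ B) ×ˢ B ×ˢ B).filter fun x => op x.1.1 x.2.1 = op x.1.2 x.2.2).card : ℝ)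
      ≤ 800 * H ^ 2 * m ^ 14) :
    ∃ S ⊆ B,
      (∀ a ∈ S, ∀ b ∈ S, ∀ c ∈ S, ∀ d ∈ S, op a b = op c d →
        (a = c ∧ b = d) ∨ (a = d ∧ b = c)) ∧
      (∀ a ∈ S, ∀ b ∈ S, ∀ c ∈ S, ∀ d ∈ S, ψ a + ψ b = ψ c + ψ d →
        (a = c ∧ b = d) ∨ (a = d ∧ b = c)) ∧
      m ^ 2 ≤ 9088 * H * S.card := by
  have hHm : 1 ≤ H * m ^ 3 := one_le_mul_of_one_le_of_one_le hH (one_le_pow₀ hm)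
  obtain ⟨r, hr, hr₁, hr₂⟩ := Nat.exists_prime_lt_and_le_two_mul ⌈70 * (H * m ^ 3)⌉₊
    (Nat.ceil_pos.2 (by positivity)).ne'
  have hr₁' : 70 * (H * m ^ 3) ≤ r :=
    (Nat.le_ceil _).trans (by exact_mod_cast hr₁.le)
  have hr₂' : (r : ℝ) ≤ 142 * (H * m ^ 3) := by
    have h1 := (Nat.ceil_lt_add_one (show 0 ≤ 70 * (H * m ^ 3) by positivity)).le
    have h2 : (r : ℝ) ≤ 2 * (⌈70 * (H * m ^ 3)⌉₊ : ℝ) := by exact_mod_cast hr₂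
    linarith
  obtain ⟨S, hSB, hS₁, hS₂, hS⟩ := exists_sidon_subset hcomm hcanc hsq hψ hr
    (by
      rintro rfl
      have : (70 : ℝ) ≤ (2 : ℕ) := by linarith
      norm_num at this) le_rfl
    (by
      have h1 : (4224 * B.card : ℝ) ≤ (r : ℝ) ^ 2 := by
        calc (4224 * B.card : ℝ) ≤ 4900 * (1 ^ 2 * (m ^ 5 * 1)) := by linarith [hB₁]
          _ ≤ 4900 * (H ^ 2 * (m ^ 5 * m)) := by gcongr
          _ = (70 * (H * m ^ 3)) ^ 2 := by ring
          _ ≤ _ := by gcongr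
      exact_mod_cast h1)
    (by
      have h1 : (128 : ℝ) * (((B ×ˢ B) ×ˢ B ×ˢ B).filter
          fun x => op x.1.1 x.2.1 = op x.1.2 x.2.2).card ≤ (r : ℝ) ^ 3 * B.card := by
        calc _ ≤ 128 * (800 * H ^ 2 * m ^ 14) := by gcongr
          _ = 102400 * (H ^ 2 * 1 * m ^ 14) := by ring
          _ ≤ 171500 * (H ^ 2 * H * m ^ 14) := by gcongr; norm_num
          _ = (70 * (H * m ^ 3)) ^ 3 * (m ^ 5 / 2) := by ring
          _ ≤ _ := by gcongr; linarith
      exact_mod_cast h1)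
  refine ⟨S, hSB, hS₁, hS₂, ?_⟩
  refine le_of_mul_le_mul_left (a := m ^ 3) ?_ (by positivity)
  have h1 : (B.card : ℝ) ≤ 32 * r * S.card := by exact_mod_cast hS
  calc m ^ 3 * m ^ 2 = m ^ 5 := by ring
    _ ≤ 2 * (32 * (r : ℝ) * (S.card : ℝ)) := by linarith
    _ ≤ 2 * (32 * (142 * (H * m ^ 3)) * (S.card : ℝ)) := by gcongr
    _ = _ := by ring

/-- At least half of every set lies in a part of the cyclic group on which addition does not
wrap around inconsistently. -/
theorem exists_half {α : Type*} [DecidableEq α] (B : Finset α) {N : ℕ} [NeZero N]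
    (f : α → ZMod N) : ∃ B' ⊆ B, B.card ≤ 2 * B'.card ∧
      ∀ a ∈ B', ∀ b ∈ B', ∀ c ∈ B', ∀ d ∈ B', f a + f b = f c + f d →
        (f a).val + (f b).val = (f c).val + (f d).val := by
  have hcard := Finset.card_filter_add_card_filter_not (s := B) (fun x => 2 * (f x).val < N)
  have hmod : ∀ a b c d : α, f a + f b = f c + f d →
      ((f a).val + (f b).val) % N = ((f c).val + (f d).val) % N := by
    intro a b c d h
    rw [← ZMod.val_add, ← ZMod.val_add, h]
  by_cases h : B.card ≤ 2 * (B.filter fun x => 2 * (f x).val < N).card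
  · refine ⟨_, Finset.filter_subset _ _, h, ?_⟩
    intro a ha b hb c hc d hd e
    have h1 := hmod a b c d e
    have ha := (Finset.mem_filter.1 ha).2
    have hb := (Finset.mem_filter.1 hb).2
    have hc := (Finset.mem_filter.1 hc).2
    have hd := (Finset.mem_filter.1 hd).2
    rwa [Nat.mod_eq_of_lt (by omega), Nat.mod_eq_of_lt (by omega)] at h1
  · refine ⟨B.filter fun x => ¬ 2 * (f x).val < N, Finset.filter_subset _ _, by omega, ?_⟩
    intro a ha b hb c hc d hd e
    have h1 := hmod a b c d e
    have ha := (Finset.mem_filter.1 ha).2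
    have hb := (Finset.mem_filter.1 hb).2
    have hc := (Finset.mem_filter.1 hc).2
    have hd := (Finset.mem_filter.1 hd).2
    have ha' := (f a).val_lt
    have hb' := (f b).val_lt
    have hc' := (f c).val_lt
    have hd' := (f d).val_lt
    rw [Nat.mod_eq_sub_mod (by omega), Nat.mod_eq_sub_mod (a := (f c).val + (f d).val) (by omega),
      Nat.mod_eq_of_lt (by omega), Nat.mod_eq_of_lt (by omega)] at h1
    omega

theorem exists_discreteLog (p : ℕ) [Fact p.Prime] : ∃ N : ℕ, NeZero N ∧ ∃ f : ZMod p → ZMod N,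
    (∀ x y, x ≠ 0 → y ≠ 0 → f (x * y) = f x + f y) ∧
    ∀ x y, x ≠ 0 → y ≠ 0 → f x = f y → x = y := by
  classical
  let e := zmodCyclicMulEquiv (inferInstance : IsCyclic (ZMod p)ˣ)
  refine ⟨Nat.card (ZMod p)ˣ, ⟨Nat.card_pos.ne'⟩, fun x =>
    if h : x = 0 then 0 else Multiplicative.toAdd (e.symm (Units.mk0 x h)), ?_, ?_⟩
  · intro x y hx hy
    simp only [dif_neg hx, dif_neg hy, dif_neg (mul_ne_zero hx hy), Units.mk0_mul, map_mul,
      toAdd_mul]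
  · intro x y hx hy h
    simp only [dif_neg hx, dif_neg hy] at h
    have := e.symm.injective (Multiplicative.toAdd.injective h)
    exact (Units.mk0_inj hx hy).1 this

theorem isBiSidon_of_forall {α : Type*} [Add α] [Mul α] {S : Set α}
    (h₁ : ∀ a ∈ S, ∀ b ∈ S, ∀ c ∈ S, ∀ d ∈ S, a + b = c + d → (a = c ∧ b = d) ∨ (a = d ∧ b = c))
    (h₂ : ∀ a ∈ S, ∀ b ∈ S, ∀ c ∈ S, ∀ d ∈ S, a * b = c * d →
      (a = c ∧ b = d) ∨ (a = d ∧ b = c)) : IsBiSidon S :=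
  ⟨fun a ha b hb c hc d hd h => Set.pair_eq_pair_iff.2 (h₁ a ha b hb c hc d hd h),
    fun a ha b hb c hc d hd h => Set.pair_eq_pair_iff.2 (h₂ a ha b hb c hc d hd h)⟩

/-- The bi-Sidon subset, for a set on which both operations embed into addition of natural
numbers. -/
theorem exists_isBiSidon_subset {p : ℕ} [Fact p.Prime] {A : Finset (ZMod p)} (h0 : 0 ∉ A)
    (hn : 1 ≤ A.card) {m : ℝ} (hm1 : 1 ≤ m) (hm : m ^ 5 = A.card) (hp : m ^ 16 ≤ (p : ℝ) ^ 2)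
    {ψ χ : ZMod p → ℕ} (hψ : Set.InjOn ψ A) (hχ : Set.InjOn χ A)
    (hψadd : ∀ a ∈ A, ∀ b ∈ A, ∀ c ∈ A, ∀ d ∈ A, a + b = c + d → ψ a + ψ b = ψ c + ψ d)
    (hχmul : ∀ a ∈ A, ∀ b ∈ A, ∀ c ∈ A, ∀ d ∈ A, a * b = c * d → χ a + χ b = χ c + χ d) :
    ∃ S ⊆ A, IsBiSidon (S : Set (ZMod p)) ∧
      m ^ 2 ≤ 9088 * (1 + Real.log A.card) * S.card := by
  obtain ⟨C, hCA, hC, hD⟩ := exists_energy_decomposition h0 (by linarith) hm hp hn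
  have hH : 1 ≤ 1 + Real.log A.card := by
    have := Real.log_natCast_nonneg A.card
    linarith
  have hcard := Finset.card_sdiff_add_card_eq_card hCA
  rcases le_total A.card (2 * C.card) with h | h
  · obtain ⟨S, hS, h₁, h₂, h₃⟩ := exists_sidon_subset_of_card_le (B := C) (op := fun a b => a + b)
      add_comm (fun a _ b _ c _ h => add_left_cancel h)
      (fun a ha b hb h => hψ (hCA ha) (hCA hb) (by
        have := hψadd a (hCA ha) a (hCA ha) b (hCA hb) b (hCA hb) h
        omega))
      (hχ.mono (Finset.coe_subset.2 hCA)) hm1 hH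
      (by rw [hm]; exact_mod_cast Finset.card_le_card hCA) (by rw [hm]; exact_mod_cast h) hC
    refine ⟨S, hS.trans hCA, isBiSidon_of_forall h₁ fun a ha b hb c hc d hd e => ?_, h₃⟩
    exact h₂ a ha b hb c hc d hd (hχmul a (hCA (hS ha)) b (hCA (hS hb)) c (hCA (hS hc))
      d (hCA (hS hd)) e)
  · have hDA : A \ C ⊆ A := Finset.sdiff_subset
    obtain ⟨S, hS, h₁, h₂, h₃⟩ := exists_sidon_subset_of_card_le (B := A \ C)
      (op := fun a b => a * b)
      mul_comm (fun a ha b _ c _ h => mul_left_cancel₀ (fun e => h0 (e ▸ hDA ha)) h)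
      (fun a ha b hb h => hχ (hDA ha) (hDA hb) (by
        have := hχmul a (hDA ha) a (hDA ha) b (hDA hb) b (hDA hb) h
        omega))
      (hψ.mono (Finset.coe_subset.2 hDA)) hm1 hH
      (by rw [hm]; exact_mod_cast Finset.card_le_card hDA)
      (by rw [hm]; exact_mod_cast (by omega : A.card ≤ 2 * (A \ C).card)) hD
    refine ⟨S, hS.trans hDA, isBiSidon_of_forall (fun a ha b hb c hc d hd e => ?_) h₁, h₃⟩
    exact h₂ a ha b hb c hc d hd (hψadd a (hDA (hS ha)) b (hDA (hS hb)) c (hDA (hS hc))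
      d (hDA (hS hd)) e)

theorem bi_sidon_Fp :
    ∃ c > (0 : ℝ), ∃ C ≥ (0 : ℝ), ∀ p : ℕ, p.Prime → ∀ A : Finset (ZMod p),
      2 ≤ A.card → (A.card : ℝ) ≤ (p : ℝ) ^ ((5 : ℝ) / 8) →
      ∃ S ⊆ A, IsBiSidon (S : Set (ZMod p)) ∧
        c * (A.card : ℝ) ^ ((2 : ℝ) / 5) * (Real.log A.card) ^ (-C) ≤ S.card := by
  refine ⟨1 / 300000, by norm_num, 1, by norm_num, ?_⟩
  intro p hp A hA2 hAp
  have : Fact p.Prime := ⟨hp⟩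
  obtain ⟨N, hN, f, hfmul, hfinj⟩ := exists_discreteLog p
  obtain ⟨A₁, hA₁, hc₁, hadd⟩ := exists_half (A.erase 0) (fun x : ZMod p => x)
  obtain ⟨A₂, hA₂, hc₂, hmul⟩ := exists_half A₁ f
  have hne : ∀ x ∈ A₂, x ≠ 0 := fun x hx => Finset.ne_of_mem_erase (hA₁ (hA₂ hx))
  have hsub : A₂ ⊆ A := (hA₂.trans hA₁).trans (Finset.erase_subset _ _)
  have herase := Finset.pred_card_le_card_erase (a := (0 : ZMod p)) (s := A)
  have hn : 1 ≤ A₂.card := by omega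
  have hn8 : A.card ≤ 8 * A₂.card := by omega
  have hnA := Finset.card_le_card hsub
  have hnR : (1 : ℝ) ≤ A₂.card := by exact_mod_cast hn
  have hAR : (2 : ℝ) ≤ A.card := by exact_mod_cast hA2
  set m : ℝ := (A₂.card : ℝ) ^ ((1 : ℝ) / 5) with hm_def
  have hm1 : 1 ≤ m := Real.one_le_rpow hnR (by norm_num)
  have hm : m ^ 5 = A₂.card := by
    rw [hm_def, ← Real.rpow_natCast, ← Real.rpow_mul (by positivity)]
    norm_num
  have hmp : m ^ 16 ≤ (p : ℝ) ^ 2 := by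
    have h1 : (A₂.card : ℝ) ≤ (p : ℝ) ^ ((5 : ℝ) / 8) := le_trans (by exact_mod_cast hnA) hAp
    have h2 : m ≤ (p : ℝ) ^ ((1 : ℝ) / 8) := by
      calc m ≤ ((p : ℝ) ^ ((5 : ℝ) / 8)) ^ ((1 : ℝ) / 5) :=
            Real.rpow_le_rpow (by positivity) h1 (by norm_num)
        _ = _ := by rw [← Real.rpow_mul (by positivity)]; norm_num
    calc m ^ 16 ≤ ((p : ℝ) ^ ((1 : ℝ) / 8)) ^ 16 := by gcongr
      _ = _ := by
        rw [← Real.rpow_natCast, ← Real.rpow_mul (by positivity), ← Real.rpow_natCast]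
        norm_num
  obtain ⟨S, hS, hSidon, hcard⟩ := exists_isBiSidon_subset (A := A₂) (fun h => hne 0 h rfl) hn
    hm1 hm hmp (ψ := fun x => x.val) (χ := fun x => (f x).val)
    (fun x _ y _ h => ZMod.val_injective p h)
    (fun x hx y hy h => hfinj x y (hne x hx) (hne y hy) (ZMod.val_injective N h))
    (fun a ha b hb c hc d hd h => hadd a (hA₂ ha) b (hA₂ hb) c (hA₂ hc) d (hA₂ hd) h)
    (fun a ha b hb c hc d hd h => hmul a ha b hb c hc d hd (by
      rw [← hfmul a b (hne a ha) (hne b hb), h, hfmul c d (hne c hc) (hne d hd)]))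
  refine ⟨S, hS.trans hsub, hSidon, ?_⟩
  have hlog2 : (1 : ℝ) / 2 ≤ Real.log A.card :=
    le_trans (by linarith [Real.log_two_gt_d9]) (Real.log_le_log (by norm_num) hAR)
  have hH : 1 + Real.log A₂.card ≤ 3 * Real.log A.card := by
    have : Real.log A₂.card ≤ Real.log A.card :=
      Real.log_le_log (by positivity) (by exact_mod_cast hnA)
    linarith
  have hAm : (A.card : ℝ) ^ ((2 : ℝ) / 5) ≤ 8 * m ^ 2 := by
    have h8 : (8 : ℝ) ^ ((2 : ℝ) / 5) ≤ 8 := by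
      calc (8 : ℝ) ^ ((2 : ℝ) / 5) ≤ (8 : ℝ) ^ (1 : ℝ) :=
            Real.rpow_le_rpow_of_exponent_le (by norm_num) (by norm_num)
        _ = 8 := Real.rpow_one 8
    calc (A.card : ℝ) ^ ((2 : ℝ) / 5) ≤ (8 * A₂.card : ℝ) ^ ((2 : ℝ) / 5) :=
          Real.rpow_le_rpow (by positivity) (by exact_mod_cast hn8) (by norm_num)
      _ = (8 : ℝ) ^ ((2 : ℝ) / 5) * (A₂.card : ℝ) ^ ((2 : ℝ) / 5) :=
          Real.mul_rpow (by norm_num) (by positivity)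
      _ = (8 : ℝ) ^ ((2 : ℝ) / 5) * m ^ 2 := by
          rw [hm_def, ← Real.rpow_natCast, ← Real.rpow_mul (by positivity)]
          norm_num
      _ ≤ _ := by gcongr
  rw [Real.rpow_neg_one, ← div_eq_mul_inv, div_le_iff₀ (by linarith)]
  have h1 : m ^ 2 ≤ 9088 * (3 * Real.log A.card) * S.card := hcard.trans (by gcongr)
  have h2 : 0 ≤ Real.log A.card * S.card := by positivity
  linarith
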